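/- arXiv:1603.06357 — 3 statements merged into one kernel-verified Lean document; each statement's English description precedes it below -/
import Mathlib

section
/- For every complex number q with |q| < 1, the infinite product ∏_{n≥1} (1−q^n)²/(1−q^n+q^{2n}) converges and equals the sum of the power series ∑_{n≥0} c(n) q^n, where c(0) = 1 and, for every integer m ≥ 0: c(3m) = (−1)^m · r(3m) (for m ≥ 1), c(3m+1) = (−1)^{m+1} · r(3m+1)/4, and c(3m+2) = (−1)^{m+1} · r(3m+2)/2. -/
/-- `r n` is the number of representations of `n` as a sum of two squares of integers. -/
noncomputable def r (n : ℕ) : ℕ := Set.ncard {p : ℤ × ℤ | p.1 ^ 2 + p.2 ^ 2 = (n : ℤ)}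

/-- The coefficients `c n`: `c 0 = 1`, `c (3m) = (-1)^m r(3m)` for `m ≥ 1`,
`c (3m+1) = (-1)^(m+1) r(3m+1)/4`, `c (3m+2) = (-1)^(m+1) r(3m+2)/2`. -/
noncomputable def c (n : ℕ) : ℂ :=
  if n = 0 then 1
  else if n % 3 = 0 then (-1) ^ (n / 3) * (r n : ℂ)
  else if n % 3 = 1 then (-1) ^ (n / 3 + 1) * (r n : ℂ) / 4
  else (-1) ^ (n / 3 + 1) * (r n : ℂ) / 2

open Finset Filter Topology

/-- The ratio `(q)ₙ² / ((q)ₙ₋ₖ (q)ₙ₊ₖ)` of `q`-factorials; it vanishes for `k > n`. -/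
noncomputable def qRatio (q : ℂ) (n k : ℕ) : ℂ :=
  ∏ i ∈ range k, (1 - q ^ (n - i)) / (1 - q ^ (n + i + 1))

/-- The `(k + 1)`-st term of the Appell-Lerch series, up to the factor `2 - s`. -/
noncomputable def appellTerm (s q : ℂ) (k : ℕ) : ℂ :=
  (-1) ^ (k + 1) * q ^ (k + 2).choose 2 * ((1 + q ^ (k + 1)) / (1 - s * q ^ (k + 1) + q ^ (2 * (k + 1))))

/-- Partial fraction expansion of `∏ (1 - q ^ j)² / (1 - s q ^ j + q ^ (2 j))` over `1 ≤ j ≤ n`. -/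
noncomputable def appellSum (s q : ℂ) (n : ℕ) : ℂ :=
  1 + (2 - s) * ∑ k ∈ range n, appellTerm s q k * qRatio q n (k + 1)

/-- Finite version of the theta series `∑ (-1) ^ k q ^ (k²)` over `k ∈ ℤ`. -/
noncomputable def thetaSum (q : ℂ) (n : ℕ) : ℂ :=
  1 + 2 * ∑ k ∈ range n, (-1) ^ (k + 1) * q ^ (k + 1) ^ 2 * qRatio q n (k + 1)

lemma one_sub_pow_ne_zero {q : ℂ} (hq : ‖q‖ < 1) {n : ℕ} (hn : n ≠ 0) : 1 - q ^ n ≠ 0 := by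
  intro h
  have h1 : ‖q ^ n‖ = 1 := by rw [← sub_eq_zero.mp h, norm_one]
  rw [norm_pow] at h1
  exact (pow_lt_one₀ (norm_nonneg q) hq hn).ne h1

lemma one_add_pow_ne_zero {q : ℂ} (hq : ‖q‖ < 1) {n : ℕ} (hn : n ≠ 0) : 1 + q ^ n ≠ 0 := by
  intro h
  have h1 : ‖q ^ n‖ = 1 := by rw [← neg_eq_of_add_eq_zero_right h, norm_neg, norm_one]
  rw [norm_pow] at h1
  exact (pow_lt_one₀ (norm_nonneg q) hq hn).ne h1

lemma choose_two_succ (k : ℕ) : (k + 1).choose 2 = k.choose 2 + k := by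
  rw [Nat.choose_succ_succ' k 1, Nat.choose_one_right, add_comm]

lemma qRatio_zero_right (q : ℂ) (n : ℕ) : qRatio q n 0 = 1 := by simp [qRatio]

lemma qRatio_succ_right {q : ℂ} (hq : ‖q‖ < 1) (n k : ℕ) :
    qRatio q n (k + 1) * (1 - q ^ (n + k + 1)) = qRatio q n k * (1 - q ^ (n - k)) := by
  rw [qRatio, prod_range_succ, ← qRatio, mul_assoc,
    div_mul_cancel₀ _ (one_sub_pow_ne_zero hq (by omega))]

lemma qRatio_eq_zero {q : ℂ} {n k : ℕ} (h : n < k) : qRatio q n k = 0 :=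
  prod_eq_zero (i := n) (by simpa using h) (by simp)

lemma qRatio_succ_left {q : ℂ} (hq : ‖q‖ < 1) {n k : ℕ} (hk : k ≤ n + 1) :
    qRatio q (n + 1) k * ((1 - q ^ (n + 1 - k)) * (1 - q ^ (n + 1 + k))) =
      qRatio q n k * (1 - q ^ (n + 1)) ^ 2 := by
  induction k with
  | zero => simp [qRatio_zero_right]; ring
  | succ k ih =>
    have h1 := qRatio_succ_right hq (n + 1) k
    have h2 := qRatio_succ_right hq n k
    have h3 := ih (by omega)
    have e1 : n + 1 - (k + 1) = n - k := by omega
    have e2 : n + 1 + (k + 1) = n + 1 + k + 1 := by omega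
    have e3 : n + k + 1 = n + 1 + k := by omega
    rw [e3] at h2
    rw [e1, e2]
    have h0 : 1 - q ^ (n + 1 + k) ≠ 0 := one_sub_pow_ne_zero hq (by omega)
    apply mul_right_cancel₀ h0
    linear_combination (1 - q ^ (n - k)) * (1 - q ^ (n + 1 + k)) * h1 + (1 - q ^ (n - k)) * h3
      - (1 - q ^ (n + 1)) ^ 2 * h2

lemma sum_qRatio_telescope {q : ℂ} (hq : ‖q‖ < 1) {n K : ℕ} (hK : K ≤ n) :
    (1 - q ^ n) * (1 + ∑ k ∈ range K,
      (-1) ^ (k + 1) * q ^ (k + 1).choose 2 * (1 + q ^ (k + 1)) * qRatio q n (k + 1)) =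
    (-1) ^ K * q ^ (K + 1).choose 2 * qRatio q n K * (1 - q ^ (n - K)) := by
  induction K with
  | zero => simp [qRatio_zero_right]
  | succ K ih =>
    have h1 := qRatio_succ_right hq n K
    rw [sum_range_succ, ← add_assoc, mul_add, ih (by omega), choose_two_succ (K + 1)]
    have e : q ^ n = q ^ (n - (K + 1)) * q ^ (K + 1) := by rw [← pow_add]; congr 1; omega
    have e2 : q ^ (n + K + 1) = q ^ n * q ^ (K + 1) := by rw [← pow_add]; congr 1
    rw [e2] at h1
    rw [pow_add q, pow_succ (-1 : ℂ) K]
    rw [e] at h1 ⊢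
    linear_combination (-(-1) ^ K * q ^ (K + 1).choose 2) * h1

lemma appellSum_succ {s q : ℂ} (hq : ‖q‖ < 1)
    (hs : ∀ n : ℕ, 1 - s * q ^ (n + 1) + q ^ (2 * (n + 1)) ≠ 0) (n : ℕ) :
    appellSum s q (n + 1) * (1 - s * q ^ (n + 1) + q ^ (2 * (n + 1))) =
      appellSum s q n * (1 - q ^ (n + 1)) ^ 2 := by
  have hext : appellSum s q n =
      1 + (2 - s) * ∑ k ∈ range (n + 1), appellTerm s q k * qRatio q n (k + 1) := by
    rw [sum_range_succ, qRatio_eq_zero (Nat.lt_succ_self n), mul_zero, add_zero, appellSum]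
  have hterm : ∀ k ∈ range (n + 1), appellTerm s q k * qRatio q (n + 1) (k + 1) *
      (1 - s * q ^ (n + 1) + q ^ (2 * (n + 1))) -
      appellTerm s q k * qRatio q n (k + 1) * (1 - q ^ (n + 1)) ^ 2 =
      q ^ (n + 1) * ((-1) ^ (k + 1) * q ^ (k + 1).choose 2 * (1 + q ^ (k + 1)) *
        qRatio q (n + 1) (k + 1)) := by
    intro k hk
    have hk' : k + 1 ≤ n + 1 := by simpa [Nat.lt_succ_iff] using hk
    rw [mul_assoc _ (qRatio q n (k + 1)), ← qRatio_succ_left hq hk', appellTerm,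
      choose_two_succ (k + 1)]
    have e : q ^ (n + 1) = q ^ (n + 1 - (k + 1)) * q ^ (k + 1) := by
      rw [← pow_add]; congr 1; omega
    have e2 : q ^ (n + 1 + (k + 1)) = q ^ (n + 1) * q ^ (k + 1) := pow_add _ _ _
    have h0 := hs k
    rw [e2, mul_comm 2 (n + 1), pow_mul q (n + 1), pow_add q ((k + 1).choose 2), e]
    rw [mul_comm 2 (k + 1), pow_mul q (k + 1)] at h0 ⊢
    generalize q ^ (k + 1) = x at *
    have hd := div_mul_cancel₀ (1 + x) h0
    linear_combination ((-1) ^ (k + 1) * q ^ (k + 1).choose 2 * x * q ^ (n + 1 - (k + 1)) *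
      qRatio q (n + 1) (k + 1)) * hd
  have h := sum_congr rfl hterm
  rw [sum_sub_distrib, ← sum_mul, ← sum_mul, ← mul_sum] at h
  have ht := sum_qRatio_telescope hq (le_refl (n + 1))
  rw [Nat.sub_self, pow_zero, sub_self, mul_zero] at ht
  have ht' := (mul_eq_zero.mp ht).resolve_left (one_sub_pow_ne_zero hq (by omega))
  rw [hext, appellSum]
  have e3 : q ^ (2 * (n + 1)) = (q ^ (n + 1)) ^ 2 := by rw [mul_comm, pow_mul]
  rw [e3] at h ⊢
  linear_combination (2 - s) * h + (2 - s) * q ^ (n + 1) * ht'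

lemma sum_theta_telescope {q : ℂ} (hq : ‖q‖ < 1) {n K : ℕ} (hK : K ≤ n) :
    1 - q ^ n + ∑ k ∈ range K, (-1) ^ (k + 1) *
      (q ^ ((k + 1) * (k + 2)) + q ^ (k * (k + 1)) - 2 * q ^ n * q ^ (k + 1) ^ 2) *
        qRatio q n (k + 1) =
    (-1) ^ K * q ^ (K * (K + 1)) * qRatio q n K * (1 - q ^ (n - K)) := by
  induction K with
  | zero => simp [qRatio_zero_right]
  | succ K ih =>
    have h1 := qRatio_succ_right hq n K
    rw [sum_range_succ, ← add_assoc, ih (by omega)]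
    have e : q ^ n = q ^ (n - (K + 1)) * q ^ (K + 1) := by rw [← pow_add]; congr 1; omega
    have e2 : q ^ (n + K + 1) = q ^ n * q ^ (K + 1) := by rw [← pow_add]; congr 1
    have e3 : q ^ (K + 1) ^ 2 = q ^ (K * (K + 1)) * q ^ (K + 1) := by
      rw [← pow_add]; congr 1; ring
    have e4 : q ^ ((K + 1) * (K + 2)) = q ^ (K * (K + 1)) * q ^ (K + 1) * q ^ (K + 1) := by
      rw [← pow_add, ← pow_add]; congr 1; ring
    rw [show K + 1 + 1 = K + 2 from rfl]
    rw [e2] at h1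
    rw [e3, e4, pow_succ (-1 : ℂ) K]
    rw [e] at h1 ⊢
    linear_combination (-(-1) ^ K * q ^ (K * (K + 1))) * h1

lemma thetaSum_succ {q : ℂ} (hq : ‖q‖ < 1) (n : ℕ) :
    thetaSum q (n + 1) * (1 + q ^ (n + 1)) = thetaSum q n * (1 - q ^ (n + 1)) := by
  have hext : thetaSum q n =
      1 + 2 * ∑ k ∈ range (n + 1), (-1) ^ (k + 1) * q ^ (k + 1) ^ 2 * qRatio q n (k + 1) := by
    rw [sum_range_succ, qRatio_eq_zero (Nat.lt_succ_self n), mul_zero, add_zero, thetaSum]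
  have hterm : ∀ k ∈ range (n + 1),
      (-1) ^ (k + 1) * q ^ (k + 1) ^ 2 * qRatio q (n + 1) (k + 1) * (1 - q ^ (n + 1) * q ^ (n + 1))
      - (-1) ^ (k + 1) * q ^ (k + 1) ^ 2 * qRatio q n (k + 1) * (1 - q ^ (n + 1)) ^ 2 =
      q ^ (n + 1) * ((-1) ^ (k + 1) *
        (q ^ ((k + 1) * (k + 2)) + q ^ (k * (k + 1)) - 2 * q ^ (n + 1) * q ^ (k + 1) ^ 2) *
        qRatio q (n + 1) (k + 1)) := by
    intro k hk
    have hk' : k + 1 ≤ n + 1 := by simpa [Nat.lt_succ_iff] using hk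
    rw [mul_assoc _ (qRatio q n (k + 1)), ← qRatio_succ_left hq hk']
    have e : q ^ (n + 1) = q ^ (n + 1 - (k + 1)) * q ^ (k + 1) := by
      rw [← pow_add]; congr 1; omega
    have e2 : q ^ (n + 1 + (k + 1)) = q ^ (n + 1) * q ^ (k + 1) := pow_add _ _ _
    have e3 : q ^ (k + 1) ^ 2 = q ^ (k * (k + 1)) * q ^ (k + 1) := by
      rw [← pow_add]; congr 1; ring
    have e4 : q ^ ((k + 1) * (k + 2)) = q ^ (k * (k + 1)) * q ^ (k + 1) * q ^ (k + 1) := by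
      rw [← pow_add, ← pow_add]; congr 1; ring
    rw [e2, e3, e4, e]
    ring
  have h := sum_congr rfl hterm
  rw [sum_sub_distrib, ← sum_mul, ← sum_mul, ← mul_sum] at h
  have ht := sum_theta_telescope hq (le_refl (n + 1))
  rw [Nat.sub_self, pow_zero, sub_self, mul_zero] at ht
  apply mul_right_cancel₀ (one_sub_pow_ne_zero hq (n := n + 1) (by omega))
  rw [hext, thetaSum]
  linear_combination 2 * h + 2 * q ^ (n + 1) * ht

lemma appellSum_neg_two {q : ℂ} (hq : ‖q‖ < 1) (n : ℕ) :
    appellSum (-2) q n = thetaSum q n ^ 2 := by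
  have hfac : ∀ n : ℕ, 1 - (-2) * q ^ (n + 1) + q ^ (2 * (n + 1)) = (1 + q ^ (n + 1)) ^ 2 := by
    intro n; ring
  have h0 : ∀ n : ℕ, (1 + q ^ (n + 1)) ^ 2 ≠ 0 := fun n =>
    pow_ne_zero 2 (one_add_pow_ne_zero hq n.succ_ne_zero)
  induction n with
  | zero => simp [appellSum, thetaSum]
  | succ n ih =>
    apply mul_right_cancel₀ (h0 n)
    have h1 := appellSum_succ (s := -2) hq (fun n => by rw [hfac]; exact h0 n) n
    rw [hfac, ih] at h1
    rw [h1, ← mul_pow, ← mul_pow, thetaSum_succ hq n]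

lemma norm_qRatio_le {q : ℂ} (hq : ‖q‖ < 1) (n k : ℕ) :
    ‖qRatio q n k‖ ≤ (2 / (1 - ‖q‖)) ^ k := by
  rw [qRatio, norm_prod]
  refine (prod_le_prod (g := fun _ => 2 / (1 - ‖q‖)) (fun i _ => norm_nonneg _)
    fun i _ => ?_).trans_eq (by simp [div_pow])
  have h1 : ‖1 - q ^ (n - i)‖ ≤ 2 := by
    refine (norm_sub_le _ _).trans ?_
    have := pow_le_one₀ (n := n - i) (norm_nonneg q) hq.le
    rw [norm_one, norm_pow]; linarith
  have h2 : 1 - ‖q‖ ≤ ‖1 - q ^ (n + i + 1)‖ := by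
    have h3 := norm_sub_norm_le 1 (q ^ (n + i + 1))
    have h4 : ‖q‖ ^ (n + i + 1) ≤ ‖q‖ := pow_le_of_le_one (norm_nonneg q) hq.le (by omega)
    rw [norm_one, norm_pow] at h3
    linarith
  rw [norm_div]
  exact div_le_div₀ (by norm_num) h1 (by linarith) h2

lemma tendsto_qRatio {q : ℂ} (hq : ‖q‖ < 1) (k : ℕ) :
    Tendsto (fun n => qRatio q n k) atTop (𝓝 1) := by
  have hp := tendsto_pow_atTop_nhds_zero_of_norm_lt_one hq
  have h : ∀ i ∈ range k,
      Tendsto (fun n => (1 - q ^ (n - i)) / (1 - q ^ (n + i + 1))) atTop (𝓝 1) := by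
    intro i _
    have h1 := (hp.comp (tendsto_sub_atTop_nat i)).const_sub 1
    have h2 := (hp.comp (tendsto_add_atTop_nat (i + 1))).const_sub 1
    simpa [Function.comp_def, add_assoc, Pi.div_def] using h1.div h2 (by simp)
  simpa [qRatio] using tendsto_finsetProd _ h

lemma summable_pow_mul_pow_choose_two (M : ℝ) {ρ : ℝ} (hρ0 : 0 ≤ ρ) (hρ : ρ < 1) :
    Summable fun k : ℕ => ρ ^ (k + 2).choose 2 * M ^ (k + 1) := by
  have hlim : Tendsto (fun k : ℕ => |M| * ρ ^ (k + 2)) atTop (𝓝 0) := by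
    simpa using ((tendsto_pow_atTop_nhds_zero_of_lt_one hρ0 hρ).comp
      (tendsto_add_atTop_nat 2)).const_mul |M|
  refine summable_of_ratio_norm_eventually_le (r := 1 / 2) (by norm_num) ?_
  filter_upwards [hlim.eventually (gt_mem_nhds (by norm_num : (0 : ℝ) < 1 / 2))] with k hk
  rw [choose_two_succ (k + 2), pow_add, pow_succ M]
  calc ‖ρ ^ (k + 2).choose 2 * ρ ^ (k + 2) * (M ^ (k + 1) * M)‖
      = |M| * ρ ^ (k + 2) * ‖ρ ^ (k + 2).choose 2 * M ^ (k + 1)‖ := by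
        simp only [norm_mul, norm_pow, Real.norm_eq_abs, abs_of_nonneg hρ0]; ring
    _ ≤ _ := by gcongr

lemma tendsto_sum_mul_qRatio {q : ℂ} (hq : ‖q‖ < 1) {t : ℕ → ℂ} {C : ℝ}
    (ht : ∀ k, ‖t k‖ ≤ C * ‖q‖ ^ (k + 2).choose 2) :
    Tendsto (fun n => ∑ k ∈ range n, t k * qRatio q n (k + 1)) atTop (𝓝 (∑' k, t k)) := by
  have h : ∀ n, ∑ k ∈ range n, t k * qRatio q n (k + 1) = ∑' k, t k * qRatio q n (k + 1) := by
    intro n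
    refine (tsum_eq_sum fun k hk => ?_).symm
    rw [qRatio_eq_zero (by simpa [Nat.lt_succ_iff] using hk), mul_zero]
  simp_rw [h]
  refine tendsto_tsum_of_dominated_convergence
    ((summable_pow_mul_pow_choose_two (2 / (1 - ‖q‖)) (norm_nonneg q) hq).mul_left C)
    (fun k => ?_) (Eventually.of_forall fun n k => ?_)
  · simpa using (tendsto_qRatio hq (k + 1)).const_mul (t k)
  · rw [norm_mul, ← mul_assoc]
    exact mul_le_mul (ht k) (norm_qRatio_le hq n _) (norm_nonneg _) ((norm_nonneg _).trans (ht k))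

lemma le_choose_two (k : ℕ) : k + 1 ≤ (k + 2).choose 2 := by
  rw [choose_two_succ (k + 1)]; omega

/-- If `(2 - s) (1 + x) / (1 - s x + x²)` has the bounded Taylor coefficients `f`, the limit of
`appellSum s q` is the sum of the corresponding double series. -/
lemma hasSum_prod_of_tendsto_appellSum {s q L : ℂ} (hq : ‖q‖ < 1) {f : ℕ → ℂ} {B : ℝ}
    (hB : ∀ j, ‖f j‖ ≤ B)
    (hf : ∀ x : ℂ, ‖x‖ < 1 →
      HasSum (fun j => f j * x ^ j) ((2 - s) * ((1 + x) / (1 - s * x + x ^ 2))))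
    (hL : Tendsto (appellSum s q) atTop (𝓝 L)) :
    HasSum (fun p : ℕ × ℕ =>
      (-1) ^ (p.1 + 1) * q ^ ((p.1 + 2).choose 2 + (p.1 + 1) * p.2) * f p.2) (L - 1) := by
  have hB0 : 0 ≤ B := (norm_nonneg _).trans (hB 0)
  have hqk : ∀ k : ℕ, ‖q ^ (k + 1)‖ < 1 := fun k => by
    rw [norm_pow]; exact pow_lt_one₀ (norm_nonneg q) hq k.succ_ne_zero
  have hsum : Summable fun p : ℕ × ℕ =>
      (-1) ^ (p.1 + 1) * q ^ ((p.1 + 2).choose 2 + (p.1 + 1) * p.2) * f p.2 := by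
    have hg := summable_geometric_of_lt_one (norm_nonneg q) hq
    refine Summable.of_norm_bounded
      ((hg.mul_of_nonneg hg (fun _ => by positivity) (fun _ => by positivity)).mul_left B) ?_
    rintro ⟨k, j⟩
    simp only [norm_mul, norm_pow, norm_neg, norm_one, one_pow, one_mul]
    rw [mul_comm B, ← pow_add]
    refine mul_le_mul ?_ (hB j) (norm_nonneg _) (by positivity)
    refine pow_le_pow_of_le_one (norm_nonneg q) hq.le ?_
    have := le_choose_two k
    nlinarith
  have hrow : ∀ k : ℕ, HasSum
      (fun j => (-1) ^ (k + 1) * q ^ ((k + 2).choose 2 + (k + 1) * j) * f j)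
      ((2 - s) * appellTerm s q k) := by
    intro k
    convert! (hf _ (hqk k)).mul_left ((-1) ^ (k + 1) * q ^ (k + 2).choose 2) using 1
    · ext j; rw [pow_add q ((k + 2).choose 2), pow_mul]; ring
    · rw [appellTerm, ← pow_mul, mul_comm (k + 1) 2]; ring
  have hbound : ∀ k, ‖(2 - s) * appellTerm s q k‖ ≤ B / (1 - ‖q‖) * ‖q‖ ^ (k + 2).choose 2 := by
    intro k
    have h1 : HasSum (fun j => B * ‖q‖ ^ j) (B / (1 - ‖q‖)) :=
      (hasSum_geometric_of_lt_one (norm_nonneg q) hq).mul_left B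
    have h2 : ‖(2 - s) * ((1 + q ^ (k + 1)) / (1 - s * q ^ (k + 1) + (q ^ (k + 1)) ^ 2))‖ ≤
        B / (1 - ‖q‖) := by
      rw [← (hf _ (hqk k)).tsum_eq]
      refine tsum_of_norm_bounded h1 fun j => ?_
      rw [norm_mul, ← pow_mul, norm_pow]
      exact mul_le_mul (hB j) (pow_le_pow_of_le_one (norm_nonneg q) hq.le (by nlinarith))
        (by positivity) hB0
    rw [appellTerm, mul_comm 2 (k + 1), pow_mul]
    calc _ = ‖(2 - s) * ((1 + q ^ (k + 1)) / (1 - s * q ^ (k + 1) + (q ^ (k + 1)) ^ 2))‖ *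
          ‖q‖ ^ (k + 2).choose 2 := by
          simp only [norm_mul, norm_pow, norm_neg, norm_one, one_pow]; ring
      _ ≤ _ := by gcongr
  have hlim := (tendsto_sum_mul_qRatio hq hbound).const_add 1
  have heq : (fun n => 1 + ∑ k ∈ range n, (2 - s) * appellTerm s q k * qRatio q n (k + 1)) =
      appellSum s q := by
    ext n; simp only [appellSum, mul_sum, mul_assoc]
  rw [heq] at hlim
  have hL' := tendsto_nhds_unique hL hlim
  have h := hsum.hasSum
  have h3 := (h.prod_fiberwise hrow).tsum_eq
  rwa [hL', add_sub_cancel_left, h3]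

/-- The sum over factorizations `n = a b` of `(-1) ^ n χ₄(a)`, weighted by `β` if `3 ∣ a + b` and
by `α` otherwise. -/
noncomputable def twistedDivisorSum (α β : ℂ) (n : ℕ) : ℂ :=
  ∑ p ∈ n.divisorsAntidiagonal,
    (-1) ^ n * ((ZMod.χ₄ p.1 : ℤ) : ℂ) * (if 3 ∣ p.1 + p.2 then β else α)

lemma hasSum_twistedDivisorSum {α β q L : ℂ}
    (h : HasSum (fun p : ℕ × ℕ => (-1) ^ (p.1 + 1) * q ^ ((p.1 + 2).choose 2 + (p.1 + 1) * p.2) *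
      ((-1) ^ p.2 * if p.2 % 3 = 1 then β else α)) L) :
    HasSum (fun n => twistedDivisorSum α β n * q ^ n) L := by
  let F : ℕ+ × ℕ+ → ℂ := fun p => (-1) ^ (p.1 * p.2 : ℕ) * ((ZMod.χ₄ (p.1 : ℕ) : ℤ) : ℂ) *
    (if 3 ∣ (p.1 + p.2 : ℕ) then β else α) * q ^ (p.1 * p.2 : ℕ)
  let e : ℕ × ℕ → ℕ+ × ℕ+ := fun p =>
    if p.1 % 2 = 0 then (p.1.succPNat, (p.1 / 2 + p.2).succPNat)
    else ((p.1 + 2 * p.2 + 1).succPNat, (p.1 / 2).succPNat)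
  have he : Function.Injective e := by
    rintro ⟨k, j⟩ ⟨k', j'⟩ hkk
    simp only [e] at hkk
    split_ifs at hkk <;> simp only [Prod.mk.injEq, Nat.succPNat_inj] at hkk ⊢ <;> omega
  have hF : ∀ p ∉ Set.range e, F p = 0 := by
    rintro ⟨⟨a, ha⟩, ⟨b, hb⟩⟩ hp
    have ha2 : a % 2 = 0 := by
      by_contra hodd
      apply hp
      by_cases hab : a + 1 ≤ 2 * b
      · refine ⟨(a - 1, b - 1 - (a - 1) / 2), ?_⟩
        simp only [e]
        rw [if_pos (by omega)]
        refine Prod.ext (PNat.eq ?_) (PNat.eq ?_) <;> simp only [Nat.succPNat_coe, PNat.mk_coe] <;> omega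
      · refine ⟨(2 * b - 1, (a - 1) / 2 - b), ?_⟩
        simp only [e]
        rw [if_neg (by omega)]
        refine Prod.ext (PNat.eq ?_) (PNat.eq ?_) <;> simp only [Nat.succPNat_coe, PNat.mk_coe] <;> omega
    have h0 : ZMod.χ₄ (a : ZMod 4) = 0 := by rw [ZMod.χ₄_nat_eq_if_mod_four, if_pos ha2]
    simp only [F, PNat.mk_coe, h0, Int.cast_zero, mul_zero, zero_mul]
  have hFe : F ∘ e = fun p : ℕ × ℕ =>
      (-1) ^ (p.1 + 1) * q ^ ((p.1 + 2).choose 2 + (p.1 + 1) * p.2) *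
      ((-1) ^ p.2 * if p.2 % 3 = 1 then β else α) := by
    ext ⟨k, j⟩
    have hch : (k + 2) * (k + 1) = 2 * (k + 2).choose 2 := by
      rw [Nat.choose_two_right, Nat.mul_div_cancel' (Nat.even_mul_pred_self _).two_dvd]; rfl
    rcases Nat.even_or_odd' k with ⟨m, rfl | rfl⟩
    · have hexp : (2 * m + 2).choose 2 + (2 * m + 1) * j = (2 * m + 1) * (m + j + 1) := by
        linarith
      have h3 : (3 ∣ 2 * m + 1 + (m + j + 1)) ↔ j % 3 = 1 := by omega
      simp only [Function.comp, e, F, Nat.mul_mod_right, if_true, Nat.succPNat_coe, Nat.succ_eq_add_one,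
        Nat.mul_div_cancel_left m two_pos, hexp, h3]
      rw [ZMod.χ₄_eq_neg_one_pow (by omega), show (2 * m + 1) / 2 = m by omega]
      push_cast
      have hs : (-1 : ℂ) ^ ((2 * m + 1) * (m + j + 1)) * (-1) ^ m = (-1) ^ (2 * m + 1) * (-1) ^ j := by
        rw [pow_mul, Odd.neg_one_pow ⟨m, rfl⟩, ← pow_add,
          show m + j + 1 + m = 2 * m + 1 + j by ring, pow_add, Odd.neg_one_pow ⟨m, rfl⟩]
      rw [hs]; ring
    · have hexp : (2 * m + 1 + 2).choose 2 + (2 * m + 1 + 1) * j =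
          (2 * m + 1 + 2 * j + 1 + 1) * (m + 1) := by
        linarith
      have h3 : (3 ∣ 2 * m + 1 + 2 * j + 1 + 1 + (m + 1)) ↔ j % 3 = 1 := by omega
      have hk : (2 * m + 1) % 2 = 1 := by omega
      simp only [Function.comp, e, F, hk, one_ne_zero, if_false, Nat.succPNat_coe, Nat.succ_eq_add_one,
        show (2 * m + 1) / 2 = m by omega, hexp, h3]
      rw [ZMod.χ₄_eq_neg_one_pow (by omega),
        show (2 * m + 1 + 2 * j + 1 + 1) / 2 = m + 1 + j by omega]
      push_cast
      have hs : (-1 : ℂ) ^ ((2 * m + 1 + 2 * j + 1 + 1) * (m + 1)) * (-1) ^ (m + 1 + j) =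
          (-1) ^ (2 * m + 1 + 1) * (-1) ^ j := by
        rw [pow_mul, Odd.neg_one_pow ⟨m + j + 1, by ring⟩, ← pow_add,
          show m + 1 + (m + 1 + j) = 2 * m + 1 + 1 + j by ring, pow_add]
      rw [hs]; ring
  rw [← hFe, he.hasSum_iff hF, ← sigmaAntidiagonalEquivProd.hasSum_iff] at h
  have h2 := h.sigma fun n => hasSum_fintype _
  rw [← PNat.coe_injective.hasSum_iff]
  · convert! h2 using 1
    ext n
    rw [Function.comp, twistedDivisorSum, sum_mul, ← sum_coe_sort]
    refine sum_congr rfl fun p _ => ?_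
    obtain ⟨p, hp⟩ := p
    have hp' := (Nat.mem_divisorsAntidiagonal.mp hp).1
    simp [F, sigmaAntidiagonalEquivProd, divisorsAntidiagonalFactors, hp']
  · intro n hn
    have : n = 0 := by
      by_contra h0
      exact hn ⟨⟨n, Nat.pos_of_ne_zero h0⟩, rfl⟩
    simp [this, twistedDivisorSum]

lemma sum_divisorsAntidiagonal_filter_dvd_fst {M : Type*} [AddCommMonoid M] (m : ℕ) {d : ℕ}
    (hd : d ≠ 0) (h : ℕ × ℕ → M) :
    ∑ p ∈ (d * m).divisorsAntidiagonal with d ∣ p.1, h p =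
      ∑ p ∈ m.divisorsAntidiagonal, h (d * p.1, p.2) := by
  symm
  refine sum_bij (fun p _ => (d * p.1, p.2)) ?_ ?_ ?_ fun _ _ => rfl
  · rintro ⟨a, b⟩ hp
    simp only [Nat.mem_divisorsAntidiagonal, mem_filter, dvd_mul_right, and_true] at hp ⊢
    obtain ⟨rfl, h0⟩ := hp
    exact ⟨mul_assoc _ _ _, mul_ne_zero hd h0⟩
  · rintro ⟨a, b⟩ _ ⟨a', b'⟩ _ hab
    simpa [hd] using hab
  · rintro ⟨a, b⟩ hp
    simp only [Nat.mem_divisorsAntidiagonal, mem_filter] at hp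
    obtain ⟨⟨hab, h0⟩, a', rfl⟩ := hp
    refine ⟨(a', b), ?_, rfl⟩
    rw [mul_assoc] at hab
    exact Nat.mem_divisorsAntidiagonal.mpr
      ⟨Nat.eq_of_mul_eq_mul_left (Nat.pos_of_ne_zero hd) hab, right_ne_zero_of_mul h0⟩

lemma sum_divisorsAntidiagonal_filter_dvd_snd {M : Type*} [AddCommMonoid M] (m : ℕ) {d : ℕ}
    (hd : d ≠ 0) (h : ℕ × ℕ → M) :
    ∑ p ∈ (d * m).divisorsAntidiagonal with d ∣ p.2, h p =
      ∑ p ∈ m.divisorsAntidiagonal, h (p.1, d * p.2) := by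
  have hswap : ∀ (n : ℕ) (g : ℕ × ℕ → M),
      ∑ p ∈ n.divisorsAntidiagonal, g p.swap = ∑ p ∈ n.divisorsAntidiagonal, g p := by
    intro n g
    conv_rhs => rw [← Nat.map_swap_divisorsAntidiagonal, sum_map]
    rfl
  rw [sum_filter, ← hswap, ← sum_filter, ← hswap m]
  exact sum_divisorsAntidiagonal_filter_dvd_fst m hd fun p => h p.swap

/-- The divisor sum `∑ χ₄(a)` over `a ∣ n`. -/
noncomputable def chiDivisorSum (n : ℕ) : ℂ :=
  ∑ p ∈ n.divisorsAntidiagonal, ((ZMod.χ₄ p.1 : ℤ) : ℂ)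

lemma sum_chi_filter_three_dvd_add {n : ℕ} (hn : 3 ∣ n) :
    ∑ p ∈ n.divisorsAntidiagonal with 3 ∣ p.1 + p.2, ((ZMod.χ₄ p.1 : ℤ) : ℂ) =
      -chiDivisorSum n := by
  obtain ⟨m, rfl⟩ := hn
  have h1 := sum_divisorsAntidiagonal_filter_dvd_fst m three_ne_zero
    (fun p => ((ZMod.χ₄ p.1 : ℤ) : ℂ))
  have h2 := sum_divisorsAntidiagonal_filter_dvd_snd m three_ne_zero
    (fun p => ((ZMod.χ₄ p.1 : ℤ) : ℂ))
  have hchi : ∀ a : ℕ, ZMod.χ₄ ((3 * a : ℕ) : ZMod 4) = -ZMod.χ₄ (a : ZMod 4) := by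
    intro a
    rw [Nat.cast_mul, map_mul, show ZMod.χ₄ ((3 : ℕ) : ZMod 4) = -1 from rfl, neg_one_mul]
  simp only [hchi, Int.cast_neg, sum_neg_distrib] at h1
  rw [← h2] at h1
  rw [eq_neg_iff_add_eq_zero] at h1 ⊢
  rw [← h1, chiDivisorSum, sum_filter, sum_filter, sum_filter, ← sum_add_distrib,
    ← sum_add_distrib]
  refine sum_congr rfl fun p hp => ?_
  have h3 : 3 ∣ p.1 ∨ 3 ∣ p.2 := by
    rw [← Nat.prime_three.dvd_mul, (Nat.mem_divisorsAntidiagonal.mp hp).1]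
    exact dvd_mul_right 3 m
  by_cases ha : 3 ∣ p.1
  · simp only [ha, Nat.dvd_add_right ha, if_true, add_comm]
  · have hb := h3.resolve_left ha
    simp only [ha, hb, Nat.dvd_add_left hb, if_true, if_false]

lemma twistedDivisorSum_const (α : ℂ) (n : ℕ) :
    twistedDivisorSum α α n = α * (-1) ^ n * chiDivisorSum n := by
  simp only [twistedDivisorSum, chiDivisorSum, ite_self, mul_sum]
  exact sum_congr rfl fun p _ => by ring

lemma twistedDivisorSum_of_mod_three_eq_zero (α β : ℂ) {n : ℕ} (hn : n % 3 = 0) :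
    twistedDivisorSum α β n = (2 * α - β) * (-1) ^ n * chiDivisorSum n := by
  have h := sum_chi_filter_three_dvd_add (Nat.dvd_of_mod_eq_zero hn)
  have : twistedDivisorSum α β n = α * (-1) ^ n * chiDivisorSum n + (β - α) * (-1) ^ n *
      ∑ p ∈ n.divisorsAntidiagonal with 3 ∣ p.1 + p.2, ((ZMod.χ₄ p.1 : ℤ) : ℂ) := by
    rw [twistedDivisorSum, chiDivisorSum, sum_filter, mul_sum, mul_sum, ← sum_add_distrib]
    refine sum_congr rfl fun p _ => ?_
    split_ifs <;> ring
  rw [this, h]; ring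

lemma twistedDivisorSum_of_mod_three_eq_one (α β : ℂ) {n : ℕ} (hn : n % 3 = 1) :
    twistedDivisorSum α β n = α * (-1) ^ n * chiDivisorSum n := by
  rw [← twistedDivisorSum_const]
  refine sum_congr rfl fun p hp => ?_
  have hp' := (Nat.mem_divisorsAntidiagonal.mp hp).1
  rw [← hp', Nat.mul_mod] at hn
  have : ¬ 3 ∣ p.1 + p.2 := by
    have h1 : p.1 % 3 < 3 := Nat.mod_lt _ three_pos
    have h2 : p.2 % 3 < 3 := Nat.mod_lt _ three_pos
    interval_cases h3 : p.1 % 3 <;> interval_cases h4 : p.2 % 3 <;> omega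
  rw [if_neg this, ite_self]

lemma twistedDivisorSum_of_mod_three_eq_two (α β : ℂ) {n : ℕ} (hn : n % 3 = 2) :
    twistedDivisorSum α β n = β * (-1) ^ n * chiDivisorSum n := by
  rw [← twistedDivisorSum_const]
  refine sum_congr rfl fun p hp => ?_
  have hp' := (Nat.mem_divisorsAntidiagonal.mp hp).1
  rw [← hp', Nat.mul_mod] at hn
  have : 3 ∣ p.1 + p.2 := by
    have h1 : p.1 % 3 < 3 := Nat.mod_lt _ three_pos
    have h2 : p.2 % 3 < 3 := Nat.mod_lt _ three_pos
    interval_cases h3 : p.1 % 3 <;> interval_cases h4 : p.2 % 3 <;> omega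
  rw [if_pos this, ite_self]

lemma hasSum_coeff_unique {u v : ℕ → ℂ}
    (h : ∀ q : ℂ, ‖q‖ < 1 → ∃ L, HasSum (fun n => u n * q ^ n) L ∧ HasSum (fun n => v n * q ^ n) L) :
    u = v := by
  have key : ∀ w : ℕ → ℂ, (∀ q : ℂ, ‖q‖ < 1 →
      HasSum (fun n => w n * q ^ n) (∑' n, u n * q ^ n)) →
      HasFPowerSeriesAt (fun q => ∑' n, u n * q ^ n) (FormalMultilinearSeries.ofScalars ℂ w) 0 := by
    intro w hw
    rw [hasFPowerSeriesAt_iff]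
    filter_upwards [Metric.ball_mem_nhds (0 : ℂ) one_pos] with q hq
    simpa [FormalMultilinearSeries.coeff_ofScalars, mul_comm] using hw q (by simpa using hq)
  have hu := key u fun q hq => by
    obtain ⟨L, h1, -⟩ := h q hq
    exact h1.summable.hasSum
  have hv := key v fun q hq => by
    obtain ⟨L, h1, h2⟩ := h q hq
    rwa [h1.tsum_eq]
  have heq := hu.eq_formalMultilinearSeries hv
  ext n
  simpa using congrArg (fun p => p.coeff n) heq

lemma choose_two_le_sq (k : ℕ) : (k + 2).choose 2 ≤ (k + 1) ^ 2 := by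
  induction k with
  | zero => decide
  | succ k ih => rw [choose_two_succ (k + 2)]; nlinarith

lemma exists_tendsto_thetaSum {q : ℂ} (hq : ‖q‖ < 1) :
    ∃ L, Tendsto (thetaSum q) atTop (𝓝 L) ∧ HasSum (fun x : ℤ => (-q) ^ x.natAbs ^ 2) L := by
  have hbound : ∀ k : ℕ, ‖(-1) ^ (k + 1) * q ^ (k + 1) ^ 2‖ ≤ 1 * ‖q‖ ^ (k + 2).choose 2 := by
    intro k
    simp only [norm_mul, norm_pow, norm_neg, norm_one, one_pow, one_mul]
    exact pow_le_pow_of_le_one (norm_nonneg q) hq.le (choose_two_le_sq k)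
  have hsum : Summable fun k : ℕ => (-1) ^ (k + 1) * q ^ (k + 1) ^ 2 := by
    refine Summable.of_norm_bounded ?_ hbound
    simpa using summable_pow_mul_pow_choose_two 1 (norm_nonneg q) hq
  have hterm : ∀ k : ℕ, (-1) ^ (k + 1) * q ^ (k + 1) ^ 2 = (-q) ^ (k + 1) ^ 2 := by
    intro k
    rw [neg_pow q, sq (k + 1), pow_mul (-1 : ℂ)]
    rcases neg_one_pow_eq_or ℂ (k + 1) with h | h <;> rw [h]
    · rw [one_pow]
    · rw [h]
  refine ⟨_, ((tendsto_sum_mul_qRatio hq hbound).const_mul 2).const_add 1, ?_⟩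
  have h := hsum.hasSum
  generalize (∑' k : ℕ, (-1) ^ (k + 1) * q ^ (k + 1) ^ 2) = T at *
  simp_rw [hterm] at h
  rw [two_mul, ← add_assoc]
  have habs : ∀ k : ℕ, ((k : ℤ) + 1).natAbs = k + 1 := fun k => by omega
  refine HasSum.of_nat_of_neg_add_one ?_ ?_
  · rw [← hasSum_nat_add_iff' 1]
    simpa [habs] using h
  · simpa only [Int.natAbs_neg, habs] using h

lemma hasSum_r {q L : ℂ} (hL : HasSum (fun x : ℤ => q ^ x.natAbs ^ 2) L) :
    HasSum (fun n => (r n : ℂ) * q ^ n) (L ^ 2) := by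
  have hn := hL.summable.norm
  have hs := summable_mul_of_summable_norm hn hn
  have h := hL.mul hL hs
  have h2 := h.tsum_fiberwise fun p : ℤ × ℤ => p.1.natAbs ^ 2 + p.2.natAbs ^ 2
  rw [sq]
  convert! h2 using 1
  ext n
  have hset : {p : ℤ × ℤ | p.1 ^ 2 + p.2 ^ 2 = (n : ℤ)} =
      (fun p : ℤ × ℤ => p.1.natAbs ^ 2 + p.2.natAbs ^ 2) ⁻¹' {n} := by
    ext p
    simp only [Set.mem_ofPred_eq, Set.mem_preimage, Set.mem_singleton_iff]
    rw [← Int.natAbs_sq p.1, ← Int.natAbs_sq p.2]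
    norm_cast
  rw [r, hset, ← Nat.card_coe_set_eq, ← nsmul_eq_mul, ← tsum_const]
  refine tsum_congr fun p => ?_
  obtain ⟨p, hp⟩ := p
  rw [← pow_add]
  congr 1
  exact hp.symm

lemma hasSum_generating_neg_two {x : ℂ} (hx : ‖x‖ < 1) :
    HasSum (fun j => ((-1) ^ j * if j % 3 = 1 then 4 else 4) * x ^ j)
      ((2 - (-2)) * ((1 + x) / (1 - (-2) * x + x ^ 2))) := by
  have h := (hasSum_geometric_of_norm_lt_one (ξ := -x) (by rwa [norm_neg])).mul_left 4
  have h0 : 1 + x ≠ 0 := by simpa using one_add_pow_ne_zero hx one_ne_zero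
  convert! h using 1
  · ext j; rw [ite_self, neg_pow x]; ring
  · rw [show 1 - (-2) * x + x ^ 2 = (1 + x) * (1 + x) by ring, sub_neg_eq_add]
    rw [sub_neg_eq_add]
    field_simp
    norm_num

lemma one_sub_add_sq_ne_zero {x : ℂ} (hx : ‖x‖ < 1) : 1 - x + x ^ 2 ≠ 0 := by
  intro h
  apply one_add_pow_ne_zero hx three_ne_zero
  linear_combination (1 + x) * h

lemma hasSum_generating_one {x : ℂ} (hx : ‖x‖ < 1) :
    HasSum (fun j => ((-1) ^ j * if j % 3 = 1 then -2 else 1) * x ^ j)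
      ((2 - 1) * ((1 + x) / (1 - 1 * x + x ^ 2))) := by
  let f : ℕ → ℂ := fun j => (-1) ^ j * if j % 3 = 1 then -2 else 1
  have hrec : ∀ j, f (j + 2) = f (j + 1) - f j := by
    intro j
    have hj : j % 3 < 3 := Nat.mod_lt _ three_pos
    simp only [f, pow_succ, Nat.add_mod j]
    interval_cases j % 3 <;> norm_num <;> ring
  have hsum : Summable fun j => f j * x ^ j := by
    refine Summable.of_norm_bounded
      ((summable_geometric_of_lt_one (norm_nonneg x) hx).mul_left 2) fun j => ?_
    rw [norm_mul, norm_pow]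
    refine mul_le_mul_of_nonneg_right ?_ (by positivity)
    simp only [f, norm_mul, norm_pow, norm_neg, norm_one, one_pow, one_mul]
    split_ifs <;> norm_num
  obtain ⟨S, hS⟩ := hsum
  have h1 := (hasSum_nat_add_iff' 1).mpr hS
  have h2 := (hasSum_nat_add_iff' 2).mpr hS
  have h3 := (h1.mul_left x).sub (hS.mul_left (x ^ 2))
  have h4 : (fun j => x * (f (j + 1) * x ^ (j + 1)) - x ^ 2 * (f j * x ^ j)) =
      fun j => f (j + 2) * x ^ (j + 2) := by
    ext j; rw [hrec]; ring
  rw [h4] at h3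
  have h5 := h3.unique h2
  simp [f, sum_range_succ] at h5
  have h0 := one_sub_add_sq_ne_zero hx
  convert! hS using 1
  rw [one_mul]
  field_simp
  linear_combination h5

lemma r_eq_four_mul_chiDivisorSum {n : ℕ} (hn : n ≠ 0) : (r n : ℂ) = 4 * chiDivisorSum n := by
  have h := hasSum_coeff_unique (u := fun n => (if n = 0 then 1 else 0) + twistedDivisorSum 4 4 n)
    (v := fun n => r n * (-1) ^ n) fun q hq => by
      obtain ⟨L, hL, hL'⟩ := exists_tendsto_thetaSum hq
      refine ⟨L ^ 2, ?_, ?_⟩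
      · have hA : Tendsto (appellSum (-2) q) atTop (𝓝 (L ^ 2)) := by
          rw [funext (appellSum_neg_two hq)]
          exact hL.pow 2
        have h1 := hasSum_twistedDivisorSum (α := 4) (β := 4)
          (hasSum_prod_of_tendsto_appellSum (f := fun j => (-1) ^ j * if j % 3 = 1 then 4 else 4)
            hq (B := 4) (fun j => by simp) (fun x hx => hasSum_generating_neg_two hx) hA)
        have h2 := (hasSum_ite_eq (0 : ℕ) (1 : ℂ)).add h1
        convert! h2 using 1
        · ext n
          by_cases hn : n = 0 <;> simp [hn]
        · ring
      · convert! hasSum_r hL' using 2 with n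
        rw [neg_pow q]; ring
  have h' := congrFun h n
  simp only [hn, if_false, zero_add, twistedDivisorSum_const] at h'
  apply mul_right_cancel₀ (pow_ne_zero n (neg_ne_zero.mpr (one_ne_zero (α := ℂ))))
  rw [← h']; ring

lemma c_eq_twistedDivisorSum (n : ℕ) :
    c n = (if n = 0 then 1 else 0) + twistedDivisorSum 1 (-2) n := by
  by_cases hn : n = 0
  · simp [c, hn, twistedDivisorSum]
  have hpow : (-1 : ℂ) ^ n = (-1) ^ (n / 3) * (-1) ^ (n % 3) := by
    conv_lhs => rw [← Nat.div_add_mod n 3, pow_add, pow_mul, Odd.neg_one_pow (by decide)]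
  have h3 : n % 3 < 3 := Nat.mod_lt _ three_pos
  rw [c, if_neg hn, if_neg hn, r_eq_four_mul_chiDivisorSum hn, zero_add]
  rcases (by omega : n % 3 = 0 ∨ n % 3 = 1 ∨ n % 3 = 2) with h | h | h
  · rw [if_pos h, twistedDivisorSum_of_mod_three_eq_zero _ _ h, hpow, h]; ring
  · rw [if_neg (by omega), if_pos h, twistedDivisorSum_of_mod_three_eq_one _ _ h, hpow, h]; ring
  · rw [if_neg (by omega), if_neg (by omega), twistedDivisorSum_of_mod_three_eq_two _ _ h, hpow, h]
    ring

lemma multipliable_eta_quotient {q : ℂ} (hq : ‖q‖ < 1) :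
    Multipliable (fun n : ℕ =>
      (1 - q ^ (n + 1)) ^ 2 / (1 - q ^ (n + 1) + q ^ (2 * (n + 1)))) := by
  have hx : ∀ n : ℕ, ‖q ^ (n + 1)‖ < 1 := fun n => by
    rw [norm_pow]; exact pow_lt_one₀ (norm_nonneg q) hq n.succ_ne_zero
  have hlim : Tendsto (fun n : ℕ => 1 - q ^ (n + 1) + (q ^ (n + 1)) ^ 2) atTop (𝓝 1) := by
    have h := (tendsto_pow_atTop_nhds_zero_of_norm_lt_one hq).comp (tendsto_add_atTop_nat 1)
    simpa [Function.comp_def] using (h.const_sub 1).add (h.pow 2)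
  have hev := hlim.norm.eventually (lt_mem_nhds (by norm_num : (1 / 2 : ℝ) < ‖(1 : ℂ)‖))
  have hsum : Summable fun n : ℕ =>
      ‖-(q ^ (n + 1) / (1 - q ^ (n + 1) + (q ^ (n + 1)) ^ 2))‖ := by
    refine Summable.of_norm_bounded_eventually_nat (g := fun n => 2 * ‖q‖ * ‖q‖ ^ n)
      ((summable_geometric_of_lt_one (norm_nonneg q) hq).mul_left _) ?_
    filter_upwards [hev] with n hn
    rw [norm_norm, norm_neg, norm_div, norm_pow, div_le_iff₀ (by linarith), pow_succ]
    have : 0 ≤ ‖q‖ ^ n * ‖q‖ := by positivity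
    nlinarith
  convert! multipliable_one_add_of_summable hsum using 2 with n
  have h0 := one_sub_add_sq_ne_zero (hx n)
  rw [mul_comm 2, pow_mul]
  generalize q ^ (n + 1) = x at *
  rw [div_eq_iff h0, add_mul, neg_mul, div_mul_cancel₀ _ h0]
  ring

theorem eta_quotient_expansion (q : ℂ) (hq : ‖q‖ < 1) :
    Multipliable (fun n : ℕ =>
      (1 - q ^ (n + 1)) ^ 2 / (1 - q ^ (n + 1) + q ^ (2 * (n + 1)))) ∧
    HasSum (fun n : ℕ => c n * q ^ n)
      (∏' n : ℕ, (1 - q ^ (n + 1)) ^ 2 / (1 - q ^ (n + 1) + q ^ (2 * (n + 1)))) := by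
  have h0 : ∀ n : ℕ, 1 - 1 * q ^ (n + 1) + q ^ (2 * (n + 1)) ≠ 0 := fun n => by
    rw [one_mul, mul_comm 2, pow_mul]
    refine one_sub_add_sq_ne_zero ?_
    rw [norm_pow]; exact pow_lt_one₀ (norm_nonneg q) hq n.succ_ne_zero
  have hmul := multipliable_eta_quotient hq
  refine ⟨hmul, ?_⟩
  have hlim := hmul.hasProd.tendsto_prod_nat
  generalize (∏' n : ℕ, (1 - q ^ (n + 1)) ^ 2 / (1 - q ^ (n + 1) + q ^ (2 * (n + 1)))) = P at hlim ⊢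
  have hprod : (fun n => ∏ i ∈ range n,
      (1 - q ^ (i + 1)) ^ 2 / (1 - q ^ (i + 1) + q ^ (2 * (i + 1)))) = appellSum 1 q := by
    ext n
    induction n with
    | zero => simp [appellSum]
    | succ n ih =>
      have h1 := h0 n
      have h2 := appellSum_succ hq h0 n
      rw [one_mul] at h1 h2
      rw [prod_range_succ, ih, ← mul_div_assoc, div_eq_iff h1, h2]
  rw [hprod] at hlim
  have hB : ∀ j : ℕ, ‖((-1) ^ j * if j % 3 = 1 then -2 else 1 : ℂ)‖ ≤ 2 := fun j => by
    simp only [norm_mul, norm_pow, norm_neg, norm_one, one_pow, one_mul]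
    split_ifs <;> norm_num
  have h1 := hasSum_twistedDivisorSum (α := 1) (β := -2)
    (hasSum_prod_of_tendsto_appellSum (f := fun j => (-1) ^ j * if j % 3 = 1 then -2 else 1)
      hq hB (fun x hx => hasSum_generating_one hx) hlim)
  have h2 := (hasSum_ite_eq (0 : ℕ) (1 : ℂ)).add h1
  convert! h2 using 1
  · ext n
    rw [c_eq_twistedDivisorSum]
    by_cases hn : n = 0 <;> simp [hn]
  · ring
end

section
/- For every integer m ≥ 0, one has 2 · a₆(3m+2) = (−1)^{m+1} · r(3m+2), i.e. 2 · ∑_{d | 3m+2, d odd, d > 0} ξ(2(3m+2)/d − d) = (−1)^{m+1} · r(3m+2). -/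
/-- `ξ m` for odd `m`, determined by the residue of `m` modulo 12. -/
def xi (m : ℤ) : ℤ :=
  if m % 12 = 1 ∨ m % 12 = 5 then -1
  else if m % 12 = 3 then -2
  else if m % 12 = 7 ∨ m % 12 = 11 then 1
  else if m % 12 = 9 then 2
  else 0

/-- `a₆ n = ∑ ξ(2n/d − d)` over odd positive divisors `d` of `n`. -/
def a6 (n : ℕ) : ℤ :=
  ∑ d ∈ n.divisors.filter (fun d => Odd d), xi (2 * ((n : ℤ) / (d : ℤ)) - (d : ℤ))

open ZMod (χ₄)

/-- The Gaussian integers of norm `n`. -/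
def gaussianOfNorm (n : ℕ) : Set GaussianInt := {z | z.norm = n}

/-- The sum of `χ₄ d` over the divisors `d` of `n`. -/
def sumChi (n : ℕ) : ℤ := ∑ d ∈ n.divisors, χ₄ d

/-- The recursion satisfied by `∑ d ∣ n, χ₄ d` along multiplication by a prime. -/
def PrimeRecursion (f : ℕ → ℤ) : Prop :=
  ∀ p n : ℕ, p.Prime → 0 < n →
    f (p * n) = (1 + χ₄ p) * f n - χ₄ p * if p ∣ n then f (n / p) else 0

theorem PrimeRecursion.eq {f g : ℕ → ℤ} (hf : PrimeRecursion f) (hg : PrimeRecursion g)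
    (h : f 1 = g 1) : ∀ n, 0 < n → f n = g n := by
  intro n
  induction n using Nat.strong_induction_on with
  | _ n ih =>
    intro hn
    by_cases h1 : n = 1
    · rw [h1, h]
    obtain ⟨p, hp, k, rfl⟩ := Nat.exists_prime_and_dvd h1
    have hk : 0 < k := Nat.pos_of_mul_pos_left hn
    have hlt : k < p * k := by nlinarith [hp.two_le]
    rw [hf p k hp hk, hg p k hp hk, ih k hlt hk]
    split_ifs with hd
    · rw [ih (k / p) ((Nat.div_le_self k p).trans_lt hlt)
        (Nat.div_pos (Nat.le_of_dvd hk hd) hp.pos)]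
    · rfl

theorem divisors_prime_mul {p n : ℕ} (hp : p.Prime) :
    (p * n).divisors = n.divisors ∪ n.divisors.image (p * ·) := by
  rw [Nat.divisors_mul, hp.divisors]
  ext d
  simp [Finset.mem_mul]

theorem divisors_inter_image_prime_mul {p n : ℕ} (hp : p.Prime) (hn : 0 < n) :
    n.divisors ∩ n.divisors.image (p * ·) =
      if p ∣ n then (n / p).divisors.image (p * ·) else ∅ := by
  ext d
  split_ifs with h
  · obtain ⟨k, rfl⟩ := h
    have hk : 0 < k := Nat.pos_of_mul_pos_left hn
    simp only [Finset.mem_inter, Nat.mem_divisors, Finset.mem_image,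
      Nat.mul_div_cancel_left k hp.pos]
    constructor
    · rintro ⟨⟨h1, -⟩, e, -, rfl⟩
      exact ⟨e, ⟨Nat.dvd_of_mul_dvd_mul_left hp.pos h1, hk.ne'⟩, rfl⟩
    · rintro ⟨e, ⟨h1, -⟩, rfl⟩
      exact ⟨⟨Nat.mul_dvd_mul_left p h1, hn.ne'⟩, e, ⟨h1.mul_left p, hn.ne'⟩, rfl⟩
  · simp only [Finset.mem_inter, Nat.mem_divisors, Finset.mem_image, Finset.notMem_empty,
      iff_false]
    rintro ⟨⟨h1, -⟩, e, -, rfl⟩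
    exact h ((Nat.dvd_mul_right p e).trans h1)

theorem sum_image_prime_mul {p : ℕ} (hp : p.Prime) (n : ℕ) :
    ∑ d ∈ n.divisors.image (p * ·), χ₄ d = χ₄ p * sumChi n := by
  rw [Finset.sum_image fun a _ b _ h => Nat.eq_of_mul_eq_mul_left hp.pos h, sumChi,
    Finset.mul_sum]
  exact Finset.sum_congr rfl fun d _ => by rw [Nat.cast_mul, map_mul]

theorem primeRecursion_sumChi : PrimeRecursion sumChi := by
  intro p n hp hn
  have h := Finset.sum_union_inter (s₁ := n.divisors) (s₂ := n.divisors.image (p * ·))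
    (f := fun d : ℕ => χ₄ d)
  rw [← divisors_prime_mul hp, sum_image_prime_mul hp, divisors_inter_image_prime_mul hp hn] at h
  split_ifs at h ⊢ with hd
  · rw [sum_image_prime_mul hp] at h
    simp only [sumChi] at h ⊢
    linarith
  · simp only [sumChi, Finset.sum_empty] at h ⊢
    linarith

theorem mem_gaussianOfNorm {n : ℕ} {z : GaussianInt} : z ∈ gaussianOfNorm n ↔ z.norm = n := Iff.rfl

theorem norm_eq_sq_add_sq (z : GaussianInt) : z.norm = z.re ^ 2 + z.im ^ 2 := by
  rw [Zsqrtd.norm_def]; ring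

theorem r_eq_ncard (n : ℕ) : r n = (gaussianOfNorm n).ncard := by
  rw [r]
  refine Set.ncard_congr (fun p _ => ⟨p.1, p.2⟩) ?_ ?_ ?_
  · intro p hp
    simpa [mem_gaussianOfNorm, norm_eq_sq_add_sq] using hp
  · rintro ⟨a, b⟩ ⟨c, d⟩ - - h
    simpa [Zsqrtd.ext_iff] using h
  · rintro ⟨a, b⟩ h
    exact ⟨(a, b), by simpa [mem_gaussianOfNorm, norm_eq_sq_add_sq] using h, rfl⟩

theorem gaussianOfNorm_finite (n : ℕ) : (gaussianOfNorm n).Finite := by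
  refine Set.Finite.subset (((Set.finite_Icc (-(n : ℤ)) n).prod
    (Set.finite_Icc (-(n : ℤ)) n)).image fun p : ℤ × ℤ => (⟨p.1, p.2⟩ : GaussianInt)) ?_
  rintro ⟨a, b⟩ h
  rw [mem_gaussianOfNorm, norm_eq_sq_add_sq] at h
  simp only at h
  refine ⟨(a, b), ?_, rfl⟩
  simp only [Set.mem_prod, Set.mem_Icc]
  refine ⟨⟨?_, ?_⟩, ?_, ?_⟩ <;> nlinarith [Int.le_self_sq a, Int.le_self_sq b,
    Int.le_self_sq (-a), Int.le_self_sq (-b), sq_nonneg a, sq_nonneg b]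

theorem ncard_image_mul_left {z : GaussianInt} (hz : z ≠ 0) (s : Set GaussianInt) :
    ((z * ·) '' s).ncard = s.ncard :=
  Set.ncard_image_of_injective s (mul_right_injective₀ hz)

/-- Multiples of `w` among the Gaussian integers of norm `p * n`, where `w` has norm `p`. -/
theorem mem_image_mul_gaussianOfNorm {p n : ℕ} (hp : 0 < p) {w z : GaussianInt} (hw : w.norm = p) :
    z ∈ (w * ·) '' gaussianOfNorm n ↔ z ∈ gaussianOfNorm (p * n) ∧ w ∣ z := by
  have hp' : (p : ℤ) ≠ 0 := by exact_mod_cast hp.ne'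
  constructor
  · rintro ⟨v, hv, rfl⟩
    rw [mem_gaussianOfNorm] at hv
    exact ⟨by simp [mem_gaussianOfNorm, Zsqrtd.norm_mul, hv, hw], v, rfl⟩
  · rintro ⟨h, v, rfl⟩
    refine ⟨v, ?_, rfl⟩
    rw [mem_gaussianOfNorm, Zsqrtd.norm_mul, hw, Nat.cast_mul] at h
    exact mul_left_cancel₀ hp' h

theorem prime_of_norm_prime {p : ℕ} (hp : p.Prime) {w : GaussianInt} (hw : w.norm = p) : Prime w := by
  refine Irreducible.prime ⟨?_, ?_⟩
  · rw [← Zsqrtd.norm_eq_one_iff, hw]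
    simpa using hp.one_lt.ne'
  · rintro a b rfl
    rw [Zsqrtd.norm_mul] at hw
    have h : a.norm.natAbs * b.norm.natAbs = p := by rw [← Int.natAbs_mul, hw, Int.natAbs_natCast]
    rw [← Zsqrtd.norm_eq_one_iff, ← Zsqrtd.norm_eq_one_iff]
    rcases Nat.prime_mul_iff.1 (h ▸ hp) with h | h
    · exact .inr h.2
    · exact .inl h.2

theorem dvd_star_iff {w z : GaussianInt} : w ∣ star z ↔ star w ∣ z := by
  constructor
  · rintro ⟨v, hv⟩
    exact ⟨star v, by rw [← star_star z, hv, star_mul, mul_comm]⟩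
  · rintro ⟨v, rfl⟩
    exact ⟨star v, by rw [star_mul, star_star, mul_comm]⟩

theorem natCast_dvd_mul_star {p n : ℕ} {z : GaussianInt} (hz : z ∈ gaussianOfNorm (p * n)) :
    (p : GaussianInt) ∣ z * star z := by
  rw [← Zsqrtd.norm_eq_mul_conj, mem_gaussianOfNorm.1 hz]
  exact ⟨n, by push_cast; rfl⟩

theorem gaussianOfNorm_prime_mul {p n : ℕ} (hp : p.Prime) {w : GaussianInt} (hw : w.norm = p) :
    gaussianOfNorm (p * n) =
      (w * ·) '' gaussianOfNorm n ∪ (star w * ·) '' gaussianOfNorm n := by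
  have hw' : (star w).norm = p := by rw [Zsqrtd.norm_conj, hw]
  ext z
  rw [Set.mem_union, mem_image_mul_gaussianOfNorm hp.pos hw,
    mem_image_mul_gaussianOfNorm hp.pos hw', ← and_or_left, iff_self_and]
  intro hz
  have hdvd : w ∣ z * star z := by
    refine Dvd.dvd.trans ?_ (natCast_dvd_mul_star hz)
    exact ⟨star w, by rw [← Zsqrtd.norm_eq_mul_conj, hw]; rfl⟩
  rw [← dvd_star_iff]
  exact (prime_of_norm_prime hp hw).dvd_or_dvd hdvd

/-- Multiples of a natural prime `p` among the Gaussian integers of norm `p * n`. -/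
theorem setOf_natCast_dvd_gaussianOfNorm {p n : ℕ} (hp : p.Prime) :
    {z | z ∈ gaussianOfNorm (p * n) ∧ (p : GaussianInt) ∣ z} =
      if p ∣ n then ((p : GaussianInt) * ·) '' gaussianOfNorm (n / p) else ∅ := by
  have hp' : (p : ℤ) ≠ 0 := by exact_mod_cast hp.ne_zero
  split_ifs with h
  · obtain ⟨k, rfl⟩ := h
    ext z
    rw [Nat.mul_div_cancel_left k hp.pos, mem_image_mul_gaussianOfNorm (p := p * p)
      (Nat.mul_pos hp.pos hp.pos) (by rw [Zsqrtd.norm_natCast]; push_cast; rfl), mul_assoc]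
    rfl
  · rw [Set.eq_empty_iff_forall_notMem]
    rintro z ⟨hz, v, rfl⟩
    rw [mem_gaussianOfNorm, Zsqrtd.norm_mul, Zsqrtd.norm_natCast, Nat.cast_mul, mul_assoc] at hz
    exact h (Int.natCast_dvd_natCast.1 ⟨_, (mul_left_cancel₀ hp' hz).symm⟩)

theorem ncard_setOf_natCast_dvd_gaussianOfNorm {p n : ℕ} (hp : p.Prime) :
    ({z | z ∈ gaussianOfNorm (p * n) ∧ (p : GaussianInt) ∣ z}.ncard : ℤ) =
      if p ∣ n then (r (n / p) : ℤ) else 0 := by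
  rw [setOf_natCast_dvd_gaussianOfNorm hp]
  split_ifs with h
  · rw [ncard_image_mul_left (by exact_mod_cast hp.ne_zero), r_eq_ncard]
  · simp

theorem not_star_dvd_self {p : ℕ} (hp : p.Prime) (hp2 : p ≠ 2) {w : GaussianInt} (hw : w.norm = p) :
    ¬ star w ∣ w := by
  rintro ⟨v, hv⟩
  have hn := norm_eq_sq_add_sq w
  have h1 : star w * (v + 1) = ((2 * w.re : ℤ) : GaussianInt) := by
    rw [mul_add, ← hv]
    ext
    · simp; ring
    · simp
  have h2 := congrArg Zsqrtd.norm h1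
  rw [Zsqrtd.norm_mul, Zsqrtd.norm_conj, Zsqrtd.norm_intCast, hw] at h2
  have hpi : Prime (p : ℤ) := Nat.prime_iff_prime_int.1 hp
  have hp2' : ¬ (p : ℤ) ∣ 2 := fun h =>
    hp2 ((Nat.prime_dvd_prime_iff_eq hp Nat.prime_two).1 (by exact_mod_cast h))
  have hre : (p : ℤ) ∣ w.re := by
    have h3 : (p : ℤ) ∣ 2 * w.re * (2 * w.re) := ⟨_, h2.symm⟩
    rcases hpi.dvd_or_dvd h3 with h | h <;> exact (hpi.dvd_or_dvd h).resolve_left hp2'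
  have him : (p : ℤ) ∣ w.im := by
    refine hpi.dvd_of_dvd_pow (n := 2) ?_
    have : w.im ^ 2 = p - w.re ^ 2 := by linarith
    rw [this]
    exact dvd_sub dvd_rfl (hre.pow two_ne_zero)
  obtain ⟨a, ha⟩ := hre
  obtain ⟨b, hb⟩ := him
  rw [hw, ha, hb] at hn
  have h4 : (p : ℤ) * 1 = p * (p * (a ^ 2 + b ^ 2)) := by linarith
  exact hpi.not_dvd_one ⟨_, mul_left_cancel₀ hpi.ne_zero h4⟩

theorem r_two_mul (n : ℕ) : r (2 * n) = r n := by
  have hw : Zsqrtd.norm (⟨1, 1⟩ : GaussianInt) = (2 : ℕ) := by simp [Zsqrtd.norm_def]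
  have hstar : ∀ z : GaussianInt, star (⟨1, 1⟩ : GaussianInt) ∣ z →
      (⟨1, 1⟩ : GaussianInt) ∣ z := fun z h =>
    Dvd.dvd.trans ⟨⟨0, -1⟩, by ext <;> simp⟩ h
  have h := gaussianOfNorm_prime_mul (n := n) Nat.prime_two hw
  have hsub : (star (⟨1, 1⟩ : GaussianInt) * ·) '' gaussianOfNorm n ⊆
      ((⟨1, 1⟩ : GaussianInt) * ·) '' gaussianOfNorm n := by
    intro z hz
    rw [mem_image_mul_gaussianOfNorm two_pos (by rw [Zsqrtd.norm_conj, hw])] at hz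
    rw [mem_image_mul_gaussianOfNorm two_pos hw]
    exact ⟨hz.1, hstar z hz.2⟩
  rw [Set.union_eq_left.2 hsub] at h
  rw [r_eq_ncard, r_eq_ncard, h, ncard_image_mul_left (by simp [Zsqrtd.ext_iff])]

theorem r_prime_mul_of_mod_four_eq_one {p n : ℕ} (hp : p.Prime) (hp1 : p % 4 = 1) :
    (r (p * n) : ℤ) = 2 * r n - if p ∣ n then (r (n / p) : ℤ) else 0 := by
  have := Fact.mk hp
  obtain ⟨a, b, hab⟩ := Nat.Prime.sq_add_sq (p := p) (by omega)
  set w : GaussianInt := ⟨a, b⟩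
  have hw : w.norm = p := by rw [norm_eq_sq_add_sq, ← hab]; push_cast; rfl
  have hw' : (star w).norm = p := by rw [Zsqrtd.norm_conj, hw]
  have hprime := prime_of_norm_prime hp hw
  have hprime' := prime_of_norm_prime hp hw'
  have hmul : (p : GaussianInt) = w * star w := by rw [← Zsqrtd.norm_eq_mul_conj, hw]; rfl
  have hinter : (w * ·) '' gaussianOfNorm n ∩ (star w * ·) '' gaussianOfNorm n =
      {z | z ∈ gaussianOfNorm (p * n) ∧ (p : GaussianInt) ∣ z} := by
    ext z
    rw [Set.mem_inter_iff, mem_image_mul_gaussianOfNorm hp.pos hw,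
      mem_image_mul_gaussianOfNorm hp.pos hw', Set.mem_ofPred_eq, ← and_and_left, hmul]
    refine and_congr_right fun _ => ⟨?_, fun h => ⟨dvd_of_mul_right_dvd h, dvd_of_mul_left_dvd h⟩⟩
    rintro ⟨⟨v, rfl⟩, h⟩
    exact mul_dvd_mul_left w
      ((hprime'.dvd_or_dvd h).resolve_left (not_star_dvd_self hp (by omega) hw))
  have h := Set.ncard_union_add_ncard_inter ((w * ·) '' gaussianOfNorm n)
    ((star w * ·) '' gaussianOfNorm n) ((gaussianOfNorm_finite n).image _)
    ((gaussianOfNorm_finite n).image _)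
  rw [← gaussianOfNorm_prime_mul hp hw, hinter, ncard_image_mul_left hprime.ne_zero,
    ncard_image_mul_left hprime'.ne_zero, ← r_eq_ncard, ← r_eq_ncard] at h
  rw [← ncard_setOf_natCast_dvd_gaussianOfNorm hp]
  zify at h
  linarith

theorem r_prime_mul_of_mod_four_eq_three {p n : ℕ} (hp : p.Prime) (hp3 : p % 4 = 3) :
    (r (p * n) : ℤ) = if p ∣ n then (r (n / p) : ℤ) else 0 := by
  have := Fact.mk hp
  rw [← ncard_setOf_natCast_dvd_gaussianOfNorm hp, r_eq_ncard]
  congr 2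
  ext z
  rw [Set.mem_ofPred_eq, iff_self_and]
  intro hz
  rcases (GaussianInt.prime_of_nat_prime_of_mod_four_eq_three p hp3).dvd_or_dvd
    (natCast_dvd_mul_star hz) with h | h
  · exact h
  · simpa [dvd_star_iff] using h

theorem primeRecursion_r : PrimeRecursion fun n => (r n : ℤ) := by
  intro p n hp _
  rcases hp.eq_two_or_odd with rfl | hodd
  · have : χ₄ ((2 : ℕ) : ZMod 4) = 0 := by decide
    simp only [this, r_two_mul]
    ring
  · rcases Nat.odd_mod_four_iff.1 hodd with h | h
    · simp only [ZMod.χ₄_nat_one_mod_four h, r_prime_mul_of_mod_four_eq_one hp h]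
      ring
    · simp only [ZMod.χ₄_nat_three_mod_four h, r_prime_mul_of_mod_four_eq_three hp h]
      ring

theorem r_one : r 1 = 4 := by
  have h : {p : ℤ × ℤ | p.1 ^ 2 + p.2 ^ 2 = ((1 : ℕ) : ℤ)} =
      (({(1, 0), (-1, 0), (0, 1), (0, -1)} : Finset (ℤ × ℤ)) : Set (ℤ × ℤ)) := by
    ext ⟨a, b⟩
    simp only [Set.mem_ofPred_eq, Nat.cast_one, Finset.coe_insert, Finset.coe_singleton,
      Set.mem_insert_iff, Set.mem_singleton_iff, Prod.mk.injEq]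
    constructor
    · intro h
      have ha : -1 ≤ a ∧ a ≤ 1 := ⟨by nlinarith, by nlinarith⟩
      have hb : -1 ≤ b ∧ b ≤ 1 := ⟨by nlinarith, by nlinarith⟩
      obtain ⟨ha1, ha2⟩ := ha
      obtain ⟨hb1, hb2⟩ := hb
      interval_cases a <;> interval_cases b <;> simp_all
    · rintro (⟨rfl, rfl⟩ | ⟨rfl, rfl⟩ | ⟨rfl, rfl⟩ | ⟨rfl, rfl⟩) <;> norm_num
  rw [r, h, Set.ncard_coe_finset]
  rfl

/-- **The two-square theorem of Jacobi**. -/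
theorem r_eq_four_mul_sumChi {n : ℕ} (hn : 0 < n) : (r n : ℤ) = 4 * sumChi n := by
  refine PrimeRecursion.eq (g := fun n => 4 * sumChi n) primeRecursion_r ?_ ?_ n hn
  · intro p n hp hn
    simp only [primeRecursion_sumChi p n hp hn]
    split_ifs <;> ring
  · simp [r_one, sumChi]

theorem sumChi_eq_sum_odd (n : ℕ) :
    sumChi n = ∑ d ∈ n.divisors.filter (fun d => Odd d), χ₄ d := by
  rw [sumChi, Finset.sum_filter]
  refine Finset.sum_congr rfl fun d _ => ?_
  split_ifs with h
  · rfl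
  · rw [ZMod.χ₄_nat_eq_if_mod_four, if_pos (by rwa [Nat.odd_iff, Nat.mod_two_not_eq_one] at h)]

theorem xi_two_mul_sub {m d e : ℕ} (hd : Odd d) (h : d * e = 3 * m + 2) :
    xi (2 * (e : ℤ) - d) = 2 * (-1) ^ (m + 1) * χ₄ d := by
  have h3 : (d * e) % 3 = 2 := by omega
  have hmod3 : (2 * (e : ℤ) - d) % 3 = 0 := by
    rw [Nat.mul_mod] at h3
    have hd3 : d % 3 < 3 := Nat.mod_lt _ (by norm_num)
    have he3 : e % 3 < 3 := Nat.mod_lt _ (by norm_num)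
    generalize hx : d % 3 = x at *
    generalize hy : e % 3 = y at *
    interval_cases x <;> interval_cases y <;> omega
  have hd2 : d % 2 = 1 := Nat.odd_iff.1 hd
  have hparity : e % 2 = m % 2 := by
    have h2 : (d * e) % 2 = (3 * m + 2) % 2 := by rw [h]
    rw [Nat.mul_mod, hd2, one_mul, Nat.mod_mod] at h2
    omega
  have hsign : (-1 : ℤ) ^ (m + 1) = if m % 2 = 0 then -1 else 1 := by
    split_ifs with hm
    · exact Odd.neg_one_pow (Nat.odd_iff.2 (by omega))
    · exact Even.neg_one_pow (Nat.even_iff.2 (by omega))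
  rw [hsign, ZMod.χ₄_nat_eq_if_mod_four, xi]
  split_ifs <;> omega

theorem a6_three_mul_add_two (m : ℕ) :
    2 * a6 (3 * m + 2) = (-1) ^ (m + 1) * (r (3 * m + 2) : ℤ) := by
  have h : a6 (3 * m + 2) = 2 * (-1) ^ (m + 1) * sumChi (3 * m + 2) := by
    rw [a6, sumChi_eq_sum_odd, Finset.mul_sum]
    refine Finset.sum_congr rfl fun d hd => ?_
    obtain ⟨hdvd, hodd⟩ := Finset.mem_filter.1 hd
    have hmul := Nat.mul_div_cancel' (Nat.dvd_of_mem_divisors hdvd)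
    rw [← xi_two_mul_sub hodd hmul, Int.natCast_div]
  rw [h, r_eq_four_mul_sumChi (by omega)]
  ring
end

section
/- For every integer n ≥ 1, a′₆(n) = a₆(n), i.e. ∑_{x,y ∈ ℕ, x²+y²=n} a(x)·b(y) = ∑_{d | n, d odd, d > 0} ξ(2n/d − d). -/
/-- `a 0 = 1` and `a n = 2·(−1)^n` for `n > 0`. -/
def a (n : ℕ) : ℤ := if n = 0 then 1 else 2 * (-1) ^ n

/-- `b 0 = 1`, `b (3m) = 2·(−1)^m` for `m > 0`, and `b n = (−1)^{n−1}` if `3 ∤ n`. -/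
def b (n : ℕ) : ℤ :=
  if n = 0 then 1 else if n % 3 = 0 then 2 * (-1) ^ (n / 3) else (-1) ^ (n - 1)

/-- `a′₆ n = ∑ a x · b y`, the sum over all pairs `(x, y)` of non-negative integers
with `x² + y² = n`. -/
def a'6 (n : ℕ) : ℤ :=
  ∑ p ∈ (Finset.range (n + 1) ×ˢ Finset.range (n + 1)).filter
      (fun p => p.1 ^ 2 + p.2 ^ 2 = n), a p.1 * b p.2

/-- The integer points on the circle `x² + y² = n`. -/
noncomputable def circlePoints (n : ℕ) : Finset (ℤ × ℤ) :=
  (Finset.Icc (-(n : ℤ)) n ×ˢ Finset.Icc (-(n : ℤ)) n).filter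
    (fun p => p.1 ^ 2 + p.2 ^ 2 = n)

theorem mem_circlePoints {n : ℕ} {p : ℤ × ℤ} :
    p ∈ circlePoints n ↔ p.1 ^ 2 + p.2 ^ 2 = n := by
  simp only [circlePoints, Finset.mem_filter, Finset.mem_product, Finset.mem_Icc,
    and_iff_right_iff_imp]
  intro h
  refine ⟨⟨?_, ?_⟩, ?_, ?_⟩ <;> nlinarith [sq_nonneg p.1, sq_nonneg p.2]

/-- The sum of `χ₄ d` over the divisors `d` of `n`. -/
def sumChiFour (n : ℕ) : ℤ := ∑ d ∈ n.divisors, ZMod.χ₄ (d : ZMod 4)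

theorem chiFour_nat_mul (m n : ℕ) :
    ZMod.χ₄ ((m * n : ℕ) : ZMod 4) = ZMod.χ₄ (m : ZMod 4) * ZMod.χ₄ (n : ZMod 4) := by
  push_cast
  exact map_mul _ _ _

theorem sumChiFour_prime_mul {p n : ℕ} (hp : p.Prime) (hn : n ≠ 0) :
    sumChiFour (p * n) = (1 + ZMod.χ₄ (p : ZMod 4)) * sumChiFour n -
      ZMod.χ₄ (p : ZMod 4) * ∑ d ∈ n.divisors with p * d ∣ n, ZMod.χ₄ (d : ZMod 4) := by
  have hinj : Function.Injective (p * ·) := fun x y h => Nat.eq_of_mul_eq_mul_left hp.pos h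
  have hunion : (p * n).divisors = n.divisors ∪ n.divisors.image (p * ·) := by
    ext d
    simp only [Nat.mem_divisors, Finset.mem_union, Finset.mem_image]
    constructor
    · rintro ⟨h, -⟩
      by_cases hd : p ∣ d
      · obtain ⟨e, rfl⟩ := hd
        exact Or.inr ⟨e, ⟨(mul_dvd_mul_iff_left hp.ne_zero).1 h, hn⟩, rfl⟩
      · exact Or.inl ⟨((hp.coprime_iff_not_dvd.2 hd).symm).dvd_of_dvd_mul_left h, hn⟩
    · rintro (⟨h, -⟩ | ⟨e, ⟨h, -⟩, rfl⟩)
      · exact ⟨h.mul_left p, mul_ne_zero hp.ne_zero hn⟩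
      · exact ⟨mul_dvd_mul_left p h, mul_ne_zero hp.ne_zero hn⟩
  have hinter : n.divisors ∩ n.divisors.image (p * ·) =
      (n.divisors.filter (fun d => p * d ∣ n)).image (p * ·) := by
    ext d
    simp only [Nat.mem_divisors, Finset.mem_inter, Finset.mem_image, Finset.mem_filter]
    constructor
    · rintro ⟨⟨h, -⟩, e, he, rfl⟩
      exact ⟨e, ⟨he, h⟩, rfl⟩
    · rintro ⟨e, ⟨he, h⟩, rfl⟩
      exact ⟨⟨h, hn⟩, e, he, rfl⟩
  have key := Finset.sum_union_inter (s₁ := n.divisors) (s₂ := n.divisors.image (p * ·))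
    (f := fun d : ℕ => ZMod.χ₄ (d : ZMod 4))
  rw [← hunion, hinter, Finset.sum_image hinj.injOn, Finset.sum_image hinj.injOn] at key
  simp only [chiFour_nat_mul, ← Finset.mul_sum] at key
  simp only [sumChiFour]
  linarith

theorem sumChiFour_prime_mul_of_not_dvd {p n : ℕ} (hp : p.Prime) (hn : ¬ p ∣ n) :
    sumChiFour (p * n) = (1 + ZMod.χ₄ (p : ZMod 4)) * sumChiFour n := by
  have hn0 : n ≠ 0 := fun h => hn (h ▸ dvd_zero p)
  rw [sumChiFour_prime_mul hp hn0, Finset.filter_false_of_mem]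
  · simp
  · exact fun d _ h => hn (dvd_of_mul_right_dvd h)

theorem sumChiFour_prime_mul_prime_mul {p m : ℕ} (hp : p.Prime) (hm : m ≠ 0) :
    sumChiFour (p * (p * m)) = (1 + ZMod.χ₄ (p : ZMod 4)) * sumChiFour (p * m) -
      ZMod.χ₄ (p : ZMod 4) * sumChiFour m := by
  have : (p * m).divisors.filter (fun d => p * d ∣ p * m) = m.divisors := by
    ext d
    simp only [Finset.mem_filter, Nat.mem_divisors, mul_dvd_mul_iff_left hp.ne_zero]
    exact ⟨fun h => ⟨h.2, hm⟩, fun h => ⟨⟨h.1.mul_left p, mul_ne_zero hp.ne_zero hm⟩, h.1⟩⟩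
  rw [sumChiFour_prime_mul hp (mul_ne_zero hp.ne_zero hm), this]
  rfl

theorem card_circlePoints_two_mul (n : ℕ) :
    (circlePoints (2 * n)).card = (circlePoints n).card := by
  symm
  refine Finset.card_bij (fun p _ => (p.1 + p.2, p.1 - p.2)) ?_ ?_ ?_
  · intro p hp
    rw [mem_circlePoints] at *
    push_cast
    linear_combination 2 * hp
  · rintro ⟨x, y⟩ - ⟨z, w⟩ - h
    simp only [Prod.mk.injEq] at h ⊢
    omega
  · rintro ⟨x, y⟩ hp
    rw [mem_circlePoints] at hp
    push_cast at hp
    have hpar : Even (x + y) := by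
      have : Even (x ^ 2 + y ^ 2) := hp ▸ even_two_mul _
      simpa [Int.even_add, Int.even_pow] using this
    obtain ⟨k, hk⟩ := hpar
    refine ⟨(k, k - y), ?_, ?_⟩
    · rw [mem_circlePoints]
      obtain rfl : x = 2 * k - y := by omega
      simp only at hp ⊢
      linarith
    · simp only [Prod.mk.injEq]
      omega

/-- Points with both coordinates divisible by `p`. -/
theorem card_circlePoints_filter_dvd {p m : ℕ} (hp : p ≠ 0) :
    ((circlePoints (p * (p * m))).filter
      (fun z => (p : ℤ) ∣ z.1 ∧ (p : ℤ) ∣ z.2)).card = (circlePoints m).card := by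
  have hp' : (p : ℤ) ≠ 0 := by exact_mod_cast hp
  symm
  refine Finset.card_bij (fun z _ => (p * z.1, p * z.2)) ?_ ?_ ?_
  · intro z hz
    rw [Finset.mem_filter, mem_circlePoints]
    rw [mem_circlePoints] at hz
    refine ⟨?_, dvd_mul_right _ _, dvd_mul_right _ _⟩
    push_cast
    linear_combination (p : ℤ) ^ 2 * hz
  · rintro ⟨x, y⟩ - ⟨z, w⟩ - h
    simpa [hp] using h
  · rintro ⟨x, y⟩ hz
    rw [Finset.mem_filter, mem_circlePoints] at hz
    obtain ⟨h, ⟨s, rfl⟩, ⟨t, rfl⟩⟩ := hz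
    refine ⟨(s, t), ?_, rfl⟩
    rw [mem_circlePoints]
    refine mul_left_cancel₀ (pow_ne_zero 2 hp') ?_
    push_cast at h
    linear_combination h

theorem circlePoints_filter_dvd_eq_empty {p n : ℕ} (hp : p ≠ 0) (hn : ¬ p ∣ n) :
    (circlePoints (p * n)).filter (fun z => (p : ℤ) ∣ z.1 ∧ (p : ℤ) ∣ z.2) = ∅ := by
  have hp' : (p : ℤ) ≠ 0 := by exact_mod_cast hp
  refine Finset.filter_false_of_mem ?_
  rintro ⟨x, y⟩ hz ⟨⟨s, hs⟩, ⟨t, ht⟩⟩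
  simp only at hs ht
  subst hs ht
  rw [mem_circlePoints] at hz
  refine hn (Int.natCast_dvd_natCast.1 ⟨s ^ 2 + t ^ 2, ?_⟩)
  refine mul_left_cancel₀ hp' ?_
  push_cast at hz
  linear_combination -hz

theorem dvd_and_dvd_of_dvd_sq_add_sq {p : ℕ} (hp : p.Prime) (h3 : p % 4 = 3) {x y : ℤ}
    (h : (p : ℤ) ∣ x ^ 2 + y ^ 2) : (p : ℤ) ∣ x ∧ (p : ℤ) ∣ y := by
  have : Fact p.Prime := ⟨hp⟩
  have hx : ∀ x y : ℤ, (p : ℤ) ∣ x ^ 2 + y ^ 2 → (p : ℤ) ∣ y := by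
    intro x y h
    by_contra hy
    rw [← ZMod.intCast_zmod_eq_zero_iff_dvd] at h hy
    push_cast at h
    exact ZMod.mod_four_ne_three_of_sq_eq_neg_sq' hy (eq_neg_of_add_eq_zero_left h) h3
  exact ⟨hx y x (by rwa [add_comm]), hx x y h⟩

/-- Gaussian integers of norm `p * n` divisible by `u + v * i`, where `u ^ 2 + v ^ 2 = p`. -/
theorem card_circlePoints_filter_dvd_linear {p n : ℕ} (hp : p.Prime) {u v : ℤ}
    (huv : u ^ 2 + v ^ 2 = p) :
    ((circlePoints (p * n)).filter (fun z => (p : ℤ) ∣ u * z.1 + v * z.2)).card =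
      (circlePoints n).card := by
  have hp' : (p : ℤ) ≠ 0 := by exact_mod_cast hp.ne_zero
  symm
  refine Finset.card_bij (fun z _ => (u * z.1 - v * z.2, v * z.1 + u * z.2)) ?_ ?_ ?_
  · intro z hz
    rw [Finset.mem_filter, mem_circlePoints]
    rw [mem_circlePoints] at hz
    refine ⟨?_, z.1, ?_⟩
    · push_cast
      linear_combination (z.1 ^ 2 + z.2 ^ 2) * huv + p * hz
    · linear_combination z.1 * huv
  · rintro ⟨x, y⟩ - ⟨z, w⟩ - h
    simp only [Prod.mk.injEq] at h ⊢
    obtain ⟨h1, h2⟩ := h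
    constructor <;> refine mul_left_cancel₀ hp' ?_
    · linear_combination u * h1 + v * h2 - (x - z) * huv
    · linear_combination u * h2 - v * h1 - (y - w) * huv
  · rintro ⟨x, y⟩ hz
    rw [Finset.mem_filter, mem_circlePoints] at hz
    obtain ⟨h, s, hs⟩ := hz
    simp only at h hs
    push_cast at h
    have ht : (p : ℤ) ∣ u * y - v * x := by
      refine (Nat.prime_iff_prime_int.1 hp).dvd_of_dvd_pow (n := 2) ⟨p * n - p * s ^ 2, ?_⟩
      linear_combination (x ^ 2 + y ^ 2) * huv + p * h - (u * x + v * y + p * s) * hs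
    obtain ⟨t, ht⟩ := ht
    have hx : u * s - v * t = x := by
      refine mul_left_cancel₀ hp' ?_
      linear_combination v * ht - u * hs + x * huv
    have hy : v * s + u * t = y := by
      refine mul_left_cancel₀ hp' ?_
      linear_combination y * huv - u * ht - v * hs
    refine ⟨(s, t), ?_, by simp [hx, hy]⟩
    rw [mem_circlePoints]
    refine mul_left_cancel₀ hp' ?_
    rw [← h, ← hx, ← hy]
    linear_combination -(s ^ 2 + t ^ 2) * huv

theorem card_circlePoints_prime_mul_of_mod_four_eq_one {p n : ℕ} (hp : p.Prime)
    (h1 : p % 4 = 1) :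
    (circlePoints (p * n)).card + ((circlePoints (p * n)).filter
      (fun z => (p : ℤ) ∣ z.1 ∧ (p : ℤ) ∣ z.2)).card = 2 * (circlePoints n).card := by
  have : Fact p.Prime := ⟨hp⟩
  have hpp := Nat.prime_iff_prime_int.1 hp
  obtain ⟨u, v, huv⟩ := Nat.Prime.sq_add_sq (p := p) (by omega)
  have huv' : (u : ℤ) ^ 2 + (v : ℤ) ^ 2 = p := by exact_mod_cast huv
  have huv'' : (u : ℤ) ^ 2 + (-(v : ℤ)) ^ 2 = p := by rw [neg_sq, huv']
  have small : ∀ {w t : ℕ}, w ^ 2 + t ^ 2 = p → ¬ (p : ℤ) ∣ w := by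
    intro w t h hw
    have hw' : p ∣ w := Int.natCast_dvd_natCast.1 hw
    have ht' : p ∣ t := by
      have h2 : p ∣ t ^ 2 := (Nat.dvd_add_right (hw'.trans (dvd_pow_self w two_ne_zero))).1
        (dvd_of_eq h.symm)
      exact hp.dvd_of_dvd_pow h2
    have h4 : p ^ 2 ∣ p := by
      nth_rewrite 2 [← h]
      exact dvd_add (pow_dvd_pow_of_dvd hw' 2) (pow_dvd_pow_of_dvd ht' 2)
    have := Nat.le_of_dvd hp.pos h4
    nlinarith [hp.two_le]
  have hu := small huv
  have hv := small ((add_comm _ _).trans huv)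
  have h2 : ¬ (p : ℤ) ∣ 2 := by
    intro h
    have := Nat.le_of_dvd two_pos (Int.natCast_dvd_natCast.1 (by exact_mod_cast h))
    have := hp.two_le
    omega
  have key := Finset.card_union_add_card_inter
    ((circlePoints (p * n)).filter (fun z => (p : ℤ) ∣ u * z.1 + v * z.2))
    ((circlePoints (p * n)).filter (fun z => (p : ℤ) ∣ u * z.1 + -v * z.2))
  rw [card_circlePoints_filter_dvd_linear hp huv', card_circlePoints_filter_dvd_linear hp huv'',
    ← Finset.filter_or, ← Finset.filter_and, ← two_mul] at key
  rw [← key]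
  congr 2
  · symm
    refine Finset.filter_true_of_mem fun z hz => hpp.dvd_or_dvd ?_
    rw [mem_circlePoints] at hz
    push_cast at hz
    exact ⟨u ^ 2 * n - z.2 ^ 2, by linear_combination u ^ 2 * hz - z.2 ^ 2 * huv'⟩
  · refine Finset.filter_congr fun z _ => ⟨?_, ?_⟩
    · rintro ⟨h, h'⟩
      exact ⟨dvd_add (h.mul_left _) (h'.mul_left _), dvd_add (h.mul_left _) (h'.mul_left _)⟩
    · rintro ⟨h, h'⟩
      constructor
      · have := dvd_add h h'
        rw [show (u : ℤ) * z.1 + v * z.2 + (u * z.1 + -v * z.2) = 2 * (u * z.1) by ring] at this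
        exact ((hpp.dvd_or_dvd ((hpp.dvd_or_dvd this).resolve_left h2)).resolve_left hu)
      · have := dvd_sub h h'
        rw [show (u : ℤ) * z.1 + v * z.2 - (u * z.1 + -v * z.2) = 2 * (v * z.2) by ring] at this
        exact ((hpp.dvd_or_dvd ((hpp.dvd_or_dvd this).resolve_left h2)).resolve_left hv)

theorem circlePoints_filter_dvd_of_mod_four_eq_three {p n : ℕ} (hp : p.Prime) (h3 : p % 4 = 3) :
    (circlePoints (p * n)).filter (fun z => (p : ℤ) ∣ z.1 ∧ (p : ℤ) ∣ z.2) =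
      circlePoints (p * n) := by
  refine Finset.filter_true_of_mem fun z hz => dvd_and_dvd_of_dvd_sq_add_sq hp h3 ?_
  rw [mem_circlePoints] at hz
  exact ⟨n, by rw [hz]; push_cast; rfl⟩

/-- The recursion shared by the number of representations as a sum of two squares and the
divisor sum of `χ₄`. -/
theorem card_circlePoints_prime_mul {p n : ℕ} (hp : p.Prime) :
    ((circlePoints (p * n)).card : ℤ) = (1 + ZMod.χ₄ (p : ZMod 4)) * (circlePoints n).card -
      ZMod.χ₄ (p : ZMod 4) * ((circlePoints (p * n)).filter
        (fun z => (p : ℤ) ∣ z.1 ∧ (p : ℤ) ∣ z.2)).card := by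
  rcases hp.eq_two_or_odd with rfl | hodd
  · have : ZMod.χ₄ ((2 : ℕ) : ZMod 4) = 0 := by decide
    rw [this, card_circlePoints_two_mul]
    ring
  · rcases Nat.odd_mod_four_iff.1 hodd with h1 | h3
    · rw [ZMod.χ₄_nat_one_mod_four h1]
      have := card_circlePoints_prime_mul_of_mod_four_eq_one (n := n) hp h1
      push_cast [← @Nat.cast_inj ℤ] at this
      linarith
    · rw [ZMod.χ₄_nat_three_mod_four h3, circlePoints_filter_dvd_of_mod_four_eq_three hp h3]
      ring

/-- Jacobi's two-square theorem. -/
theorem card_circlePoints {n : ℕ} (hn : n ≠ 0) :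
    ((circlePoints n).card : ℤ) = 4 * sumChiFour n := by
  induction n using Nat.strong_induction_on with
  | _ n ih =>
    by_cases h1 : n = 1
    · subst h1
      decide
    · have hp := Nat.minFac_prime h1
      obtain ⟨m, hm⟩ := Nat.minFac_dvd n
      generalize n.minFac = p at hp hm
      subst hm
      have hm : m ≠ 0 := right_ne_zero_of_mul hn
      have hlt : ∀ {k : ℕ}, k ≠ 0 → k < p * k := fun hk =>
        lt_mul_of_one_lt_left (Nat.pos_of_ne_zero hk) hp.one_lt
      rw [card_circlePoints_prime_mul hp, ih m (hlt hm) hm]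
      by_cases hpm : p ∣ m
      · obtain ⟨k, rfl⟩ := hpm
        have hk : k ≠ 0 := right_ne_zero_of_mul hm
        rw [card_circlePoints_filter_dvd hp.ne_zero, ih k ((hlt hk).trans (hlt hm)) hk,
          sumChiFour_prime_mul_prime_mul hp hk]
        ring
      · rw [circlePoints_filter_dvd_eq_empty hp.ne_zero hpm,
          sumChiFour_prime_mul_of_not_dvd hp hpm]
        simp
        ring

theorem xi_eq {d e : ℕ} (hd : Odd d) :
    xi (2 * (e : ℤ) - d) = (-1) ^ (d * e) * (ZMod.χ₄ (d : ZMod 4) *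
      if (3 : ℤ) ∣ 2 * e - d then -2 else 1) := by
  have hd' := Nat.odd_iff.1 hd
  rw [pow_mul, hd.neg_one_pow, ZMod.χ₄_nat_eq_if_mod_four, if_neg (by omega)]
  unfold xi
  rcases Nat.even_or_odd e with he | he
  · have := Nat.even_iff.1 he
    rw [he.neg_one_pow]
    split_ifs <;> omega
  · have := Nat.odd_iff.1 he
    rw [he.neg_one_pow]
    split_ifs <;> omega

theorem a6_eq (n : ℕ) :
    a6 n = (-1) ^ n * (sumChiFour n - 3 * ∑ d ∈ n.divisors with
      (3 : ℤ) ∣ 2 * (n / d : ℕ) - (d : ℕ), ZMod.χ₄ (d : ZMod 4)) := by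
  have h : a6 n = ∑ d ∈ n.divisors, (-1) ^ n * (ZMod.χ₄ (d : ZMod 4) *
      if (3 : ℤ) ∣ 2 * (n / d : ℕ) - (d : ℕ) then -2 else 1) := by
    rw [a6, Finset.sum_filter]
    refine Finset.sum_congr rfl fun d hd => ?_
    split_ifs with hodd
    all_goals first
      | have h := xi_eq (e := n / d) hodd
        rw [Nat.mul_div_cancel' (Nat.dvd_of_mem_divisors hd)] at h
        simp_all
      | have hz : ZMod.χ₄ (d : ZMod 4) = 0 := by
          rw [ZMod.χ₄_nat_eq_if_mod_four, if_pos (Nat.even_iff.1 (Nat.not_odd_iff_even.1 hodd))]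
        simp [hz]
  rw [h, ← Finset.mul_sum, sumChiFour, Finset.sum_filter,
    Finset.mul_sum _ _ (3 : ℤ), ← Finset.sum_sub_distrib]
  congr 1
  refine Finset.sum_congr rfl fun d _ => ?_
  split_ifs <;> ring

theorem sum_Icc_neg_of_even (f : ℤ → ℤ) (hf : ∀ x, f (-x) = f x) (n : ℕ) :
    ∑ x ∈ Finset.Icc (-(n : ℤ)) n, f x =
      ∑ x ∈ Finset.range (n + 1), (if x = 0 then 1 else 2) * f x := by
  induction n with
  | zero => simp
  | succ n ih =>
    have : Finset.Icc (-((n + 1 : ℕ) : ℤ)) (n + 1 : ℕ) =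
        insert (-((n + 1 : ℕ) : ℤ)) (insert ((n + 1 : ℕ) : ℤ) (Finset.Icc (-(n : ℤ)) n)) := by
      ext x
      simp only [Finset.mem_Icc, Finset.mem_insert]
      push_cast
      omega
    rw [this, Finset.sum_insert, Finset.sum_insert, ih, hf, Finset.sum_range_succ _ (n + 1),
      if_neg (Nat.succ_ne_zero n)]
    · ring
    · simp
    · simp only [Finset.mem_insert, Finset.mem_Icc]
      push_cast
      omega

theorem two_mul_a_mul_b (x y : ℕ) :
    2 * (a x * b y) = (if x = 0 then 1 else 2) * ((if y = 0 then 1 else 2) *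
      ((-1) ^ (x ^ 2 + y ^ 2) * (if (3 : ℤ) ∣ y then 2 else -1))) := by
  have hsq : ∀ z : ℕ, (-1 : ℤ) ^ (z ^ 2) = (-1) ^ z := by
    intro z
    rcases Nat.even_or_odd z with h | h
    · rw [h.neg_one_pow, (h.pow_of_ne_zero two_ne_zero).neg_one_pow]
    · rw [h.neg_one_pow, h.pow.neg_one_pow]
  have ha : a x = (if x = 0 then 1 else 2) * (-1) ^ x := by
    unfold a
    split_ifs with h <;> simp [h]
  have hb : 2 * b y = (if y = 0 then 1 else 2) * ((-1) ^ y * if (3 : ℤ) ∣ y then 2 else -1) := by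
    unfold b
    by_cases h0 : y = 0
    · simp [h0]
    rw [if_neg h0, if_neg h0]
    by_cases h3 : y % 3 = 0
    · obtain ⟨m, rfl⟩ := Nat.dvd_of_mod_eq_zero h3
      rw [if_pos h3, if_pos (by push_cast; exact dvd_mul_right _ _),
        Nat.mul_div_cancel_left _ (by norm_num), pow_mul]
      norm_num
      ring
    · obtain ⟨m, rfl⟩ := Nat.exists_eq_succ_of_ne_zero h0
      rw [if_neg h3, if_neg (by omega)]
      simp [pow_succ]
  rw [ha, pow_add, hsq, hsq]
  linear_combination ((if x = 0 then 1 else 2) * (-1) ^ x) * hb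

theorem two_mul_a'6 (n : ℕ) :
    2 * a'6 n = (-1) ^ n * (3 * ((circlePoints n).filter (fun z => (3 : ℤ) ∣ z.2)).card -
      (circlePoints n).card) := by
  have hR : (-1) ^ n * (3 * (((circlePoints n).filter (fun z => (3 : ℤ) ∣ z.2)).card : ℤ) -
      (circlePoints n).card) =
      ∑ z ∈ circlePoints n, (-1) ^ n * (if (3 : ℤ) ∣ z.2 then 2 else -1) := by
    rw [← Finset.mul_sum, Finset.card_filter, Finset.card_eq_sum_ones]
    push_cast
    rw [Finset.mul_sum, ← Finset.sum_sub_distrib]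
    congr 1
    refine Finset.sum_congr rfl fun z _ => ?_
    split_ifs <;> ring
  rw [hR, a'6, circlePoints, Finset.sum_filter, Finset.sum_filter, Finset.sum_product,
    Finset.sum_product, sum_Icc_neg_of_even, Finset.mul_sum]
  · refine Finset.sum_congr rfl fun x _ => ?_
    rw [sum_Icc_neg_of_even, Finset.mul_sum, Finset.mul_sum]
    · refine Finset.sum_congr rfl fun y _ => ?_
      have hc : ((x : ℤ) ^ 2 + (y : ℤ) ^ 2 = n) ↔ x ^ 2 + y ^ 2 = n := by norm_cast
      simp only [hc]
      by_cases h : x ^ 2 + y ^ 2 = n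
      · rw [if_pos h, if_pos h, two_mul_a_mul_b, h]
      · simp [h]
    · intro y
      simp
  · intro x
    simp

theorem three_dvd_or_sq_mod_three (x : ℤ) :
    (3 ∣ x ∧ x ^ 2 % 3 = 0) ∨ (¬ 3 ∣ x ∧ x ^ 2 % 3 = 1) := by
  have h : x % 3 = 0 ∨ x % 3 = 1 ∨ x % 3 = 2 := by omega
  rcases h with h | h | h
  · exact Or.inl ⟨by omega, by simp [pow_two, Int.mul_emod, h]⟩
  · exact Or.inr ⟨by omega, by simp [pow_two, Int.mul_emod, h]⟩
  · exact Or.inr ⟨by omega, by simp [pow_two, Int.mul_emod, h]⟩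

theorem card_circlePoints_filter_three_of_mod_one {n : ℕ} (hn : n % 3 = 1) :
    2 * ((circlePoints n).filter (fun z => (3 : ℤ) ∣ z.2)).card = (circlePoints n).card := by
  have hswap : ((circlePoints n).filter (fun z => ¬ (3 : ℤ) ∣ z.2)).card =
      ((circlePoints n).filter (fun z => (3 : ℤ) ∣ z.2)).card := by
    refine Finset.card_bij (fun z _ => z.swap) ?_ (fun z _ w _ h => Prod.swap_injective h) ?_
    · intro z hz
      rw [Finset.mem_filter, mem_circlePoints] at *
      simp only [Prod.fst_swap, Prod.snd_swap]
      have := three_dvd_or_sq_mod_three z.1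
      have := three_dvd_or_sq_mod_three z.2
      omega
    · intro z hz
      refine ⟨z.swap, ?_, Prod.swap_swap z⟩
      rw [Finset.mem_filter, mem_circlePoints] at *
      simp only [Prod.fst_swap, Prod.snd_swap]
      have := three_dvd_or_sq_mod_three z.1
      have := three_dvd_or_sq_mod_three z.2
      omega
  have := Finset.card_filter_add_card_filter_not (s := circlePoints n) (fun z => (3 : ℤ) ∣ z.2)
  omega

theorem circlePoints_filter_three_of_mod_two {n : ℕ} (hn : n % 3 = 2) :
    (circlePoints n).filter (fun z => (3 : ℤ) ∣ z.2) = ∅ := by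
  refine Finset.filter_false_of_mem fun z hz => ?_
  rw [mem_circlePoints] at hz
  have := three_dvd_or_sq_mod_three z.1
  have := three_dvd_or_sq_mod_three z.2
  omega

theorem circlePoints_filter_three_of_mod_zero {n : ℕ} (hn : n % 3 = 0) :
    (circlePoints n).filter (fun z => (3 : ℤ) ∣ z.2) = circlePoints n := by
  refine Finset.filter_true_of_mem fun z hz => ?_
  rw [mem_circlePoints] at hz
  have := three_dvd_or_sq_mod_three z.1
  have := three_dvd_or_sq_mod_three z.2
  omega

theorem three_dvd_two_mul_sub_iff {d e : ℕ} :
    (3 : ℤ) ∣ 2 * (e : ℤ) - d ↔ (d * e) % 3 = 2 ∨ (3 ∣ d ∧ 3 ∣ e) := by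
  have hd : d % 3 = 0 ∨ d % 3 = 1 ∨ d % 3 = 2 := by omega
  have he : e % 3 = 0 ∨ e % 3 = 1 ∨ e % 3 = 2 := by omega
  rw [Nat.mul_mod]
  rcases hd with hd | hd | hd <;> rcases he with he | he | he <;> rw [hd, he] <;> omega

theorem a6_eq_of_mod_one {n : ℕ} (hn : n % 3 = 1) : a6 n = (-1) ^ n * sumChiFour n := by
  rw [a6_eq, Finset.filter_false_of_mem]
  · simp
  · intro d hd
    have h := Nat.mul_div_cancel' (Nat.dvd_of_mem_divisors hd)
    rw [three_dvd_two_mul_sub_iff, h]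
    rintro (h' | ⟨h', -⟩)
    · omega
    · have := h'.trans (Nat.dvd_of_mem_divisors hd)
      omega

theorem a6_eq_of_mod_two {n : ℕ} (hn : n % 3 = 2) :
    a6 n = (-1) ^ n * (-2 * sumChiFour n) := by
  rw [a6_eq, Finset.filter_true_of_mem]
  · rw [sumChiFour]
    ring
  · intro d hd
    have h := Nat.mul_div_cancel' (Nat.dvd_of_mem_divisors hd)
    rw [three_dvd_two_mul_sub_iff, h]
    exact Or.inl hn

theorem a6_eq_of_mod_zero {n : ℕ} (hn : n % 3 = 0) (hn0 : n ≠ 0) :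
    a6 n = (-1) ^ n * (4 * sumChiFour n) := by
  have hχ : ZMod.χ₄ ((3 : ℕ) : ZMod 4) = -1 := by decide
  obtain ⟨k, rfl⟩ := Nat.dvd_of_mod_eq_zero hn
  rw [a6_eq]
  by_cases hk : 3 ∣ k
  · obtain ⟨m, rfl⟩ := hk
    have hm : m ≠ 0 := by
      rintro rfl
      simp at hn0
    have hS := sumChiFour_prime_mul_prime_mul Nat.prime_three hm
    have hfil : (3 * (3 * m)).divisors.filter
        (fun d => (3 : ℤ) ∣ 2 * ((3 * (3 * m)) / d : ℕ) - (d : ℕ)) =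
        m.divisors.image (3 * ·) := by
      ext d
      simp only [Finset.mem_filter, Finset.mem_image, Nat.mem_divisors]
      constructor
      · rintro ⟨⟨hd, -⟩, h⟩
        rw [three_dvd_two_mul_sub_iff, Nat.mul_div_cancel' hd] at h
        obtain ⟨⟨e, he⟩, ⟨f, hf⟩⟩ := h.resolve_left (by omega)
        have h := Nat.mul_div_cancel' hd
        rw [hf, he] at h
        exact ⟨e, ⟨⟨f, by linarith⟩, hm⟩, he.symm⟩
      · rintro ⟨e, ⟨⟨f, rfl⟩, -⟩, rfl⟩
        have hd : 3 * e ∣ 3 * (3 * (e * f)) := ⟨3 * f, by ring⟩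
        have he : 0 < 3 * e := by
          have := left_ne_zero_of_mul hm
          omega
        refine ⟨⟨hd, hn0⟩, ?_⟩
        rw [three_dvd_two_mul_sub_iff]
        refine Or.inr ⟨dvd_mul_right _ _, f, ?_⟩
        rw [show 3 * (3 * (e * f)) = 3 * e * (3 * f) by ring, Nat.mul_div_cancel_left _ he]
    have hinj : Function.Injective ((3 : ℕ) * ·) :=
      fun x y h => Nat.eq_of_mul_eq_mul_left (by norm_num) h
    rw [hfil, Finset.sum_image hinj.injOn]
    simp only [chiFour_nat_mul, ← Finset.mul_sum]
    rw [hχ] at hS ⊢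
    rw [← sumChiFour, hS]
    ring
  · rw [sumChiFour_prime_mul_of_not_dvd Nat.prime_three hk, hχ, Finset.filter_false_of_mem]
    · simp
    · intro d hd
      have h := Nat.mul_div_cancel' (Nat.dvd_of_mem_divisors hd)
      rw [three_dvd_two_mul_sub_iff, h]
      rintro (h' | ⟨⟨e, he⟩, ⟨f, hf⟩⟩)
      · omega
      · rw [hf, he] at h
        exact hk ⟨e * f, by linarith⟩

theorem a'6_eq_a6 (n : ℕ) (hn : 1 ≤ n) : a'6 n = a6 n := by
  have hn0 : n ≠ 0 := by omega
  have h := two_mul_a'6 n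
  have hJ := card_circlePoints hn0
  have hmod : n % 3 = 1 ∨ n % 3 = 2 ∨ n % 3 = 0 := by omega
  refine mul_left_cancel₀ (two_ne_zero (α := ℤ)) ?_
  rcases hmod with h3 | h3 | h3
  · have hc : 2 * (((circlePoints n).filter (fun z => (3 : ℤ) ∣ z.2)).card : ℤ) =
        (circlePoints n).card := by
      exact_mod_cast card_circlePoints_filter_three_of_mod_one h3
    have hA : (((circlePoints n).filter (fun z => (3 : ℤ) ∣ z.2)).card : ℤ) =
        2 * sumChiFour n := by linarith
    rw [h, a6_eq_of_mod_one h3, hA, hJ]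
    ring
  · rw [h, a6_eq_of_mod_two h3, circlePoints_filter_three_of_mod_two h3, hJ]
    simp
    ring
  · rw [h, a6_eq_of_mod_zero h3 hn0, circlePoints_filter_three_of_mod_zero h3, hJ]
    ring
end
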